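/- Let w be a permutation in S_n such that the total number of occurrences of the patterns 321 and 3412 in w equals 1. Then the Bruhat interval polytopes Q_{e,w} and Q_{e,w^{-1}} are combinatorially equivalent. -/

import Mathlib

/-- `simpleT n i` is the adjacent transposition `sᵢ = (i, i+1)` (one-indexed values),
acting on `{1, …, n}` represented (zero-indexed) by `Fin n`.  It is the identity
permutation when `i` is outside the valid range `1 ≤ i ≤ n - 1`. -/
def simpleT (n : ℕ) (i : ℕ) : Equiv.Perm (Fin n) :=
  if h : 1 ≤ i ∧ i < n then Equiv.swap ⟨i - 1, by omega⟩ ⟨i, h.2⟩ else 1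

/-- The (Coxeter) length `ℓ(w)`: the minimal number of adjacent transpositions whose
product is `w`. -/
noncomputable def permLen (n : ℕ) (w : Equiv.Perm (Fin n)) : ℕ :=
  sInf {l : ℕ | ∃ word : List ℕ, word.length = l ∧ (word.map (simpleT n)).prod = w}

/-- `word` is a reduced decomposition of `w`: its product is `w` and its length is `ℓ(w)`. -/
def IsReducedWord (n : ℕ) (word : List ℕ) (w : Equiv.Perm (Fin n)) : Prop :=
  (word.map (simpleT n)).prod = w ∧ word.length = permLen n w

/-- The support of `w`: the set of letters `i` such that `sᵢ` appears in some reduced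
decomposition of `w`. -/
def permSupp (n : ℕ) (w : Equiv.Perm (Fin n)) : Set ℕ :=
  {i | ∃ word : List ℕ, IsReducedWord n word w ∧ i ∈ word}

/-- Bruhat order: `v ≤ w` iff some reduced decomposition of `v` is a subword of some
reduced decomposition of `w`. -/
def bruhatLE (n : ℕ) (v w : Equiv.Perm (Fin n)) : Prop :=
  ∃ wordv wordw : List ℕ, IsReducedWord n wordv v ∧ IsReducedWord n wordw w ∧
    wordv.Sublist wordw

/-- Strict Bruhat order. -/
def bruhatLT (n : ℕ) (v w : Equiv.Perm (Fin n)) : Prop :=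
  bruhatLE n v w ∧ v ≠ w

/-- An occurrence of the pattern `p ∈ S_k` in `w ∈ S_n`: a strictly increasing sequence
`j` of indices such that the entries of `w` along `j` are in the same relative order
as the entries of `p`. -/
def IsPatternOcc {n k : ℕ} (w : Equiv.Perm (Fin n)) (p : Equiv.Perm (Fin k))
    (j : Fin k → Fin n) : Prop :=
  StrictMono j ∧ ∀ a b : Fin k, w (j a) < w (j b) ↔ p a < p b

/-- `w` contains the pattern `p`. -/
def ContainsPattern {n k : ℕ} (w : Equiv.Perm (Fin n)) (p : Equiv.Perm (Fin k)) : Prop :=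
  ∃ j : Fin k → Fin n, IsPatternOcc w p j

/-- `w` avoids the pattern `p`. -/
def AvoidsPattern {n k : ℕ} (w : Equiv.Perm (Fin n)) (p : Equiv.Perm (Fin k)) : Prop :=
  ¬ ContainsPattern w p

/-- `w` contains the pattern `p` exactly once. -/
def ContainsPatternOnce {n k : ℕ} (w : Equiv.Perm (Fin n)) (p : Equiv.Perm (Fin k)) : Prop :=
  ∃! j : Fin k → Fin n, IsPatternOcc w p j

/-- The number of occurrences of the pattern `p` in `w`. -/
noncomputable def numOcc {n k : ℕ} (w : Equiv.Perm (Fin n)) (p : Equiv.Perm (Fin k)) : ℕ :=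
  Set.ncard {j : Fin k → Fin n | IsPatternOcc w p j}

/-- The pattern `321` (one-line notation `1↦3, 2↦2, 3↦1`), as a permutation of `Fin 3`. -/
def pattern321 : Equiv.Perm (Fin 3) := Equiv.swap 0 2

/-- The pattern `3412` (one-line notation `1↦3, 2↦4, 3↦1, 4↦2`). -/
def pattern3412 : Equiv.Perm (Fin 4) := Equiv.swap 0 2 * Equiv.swap 1 3

/-- The pattern `4231` (one-line notation `1↦4, 2↦2, 3↦3, 4↦1`). -/
def pattern4231 : Equiv.Perm (Fin 4) := Equiv.swap 0 3

/-- The pattern `4321` (one-line notation `1↦4, 2↦3, 3↦2, 4↦1`). -/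
def pattern4321 : Equiv.Perm (Fin 4) := Equiv.swap 0 3 * Equiv.swap 1 2

/-- The point `(u(1), …, u(n)) ∈ ℝⁿ` attached to a permutation `u` (one-indexed values). -/
def permPoint (n : ℕ) (u : Equiv.Perm (Fin n)) : Fin n → ℝ :=
  fun k => ((u k : ℕ) : ℝ) + 1

/-- The Bruhat interval polytope `Q_{v,w}`: the convex hull of the points
`(u(1), …, u(n))` for all `u` with `v ≤ u ≤ w` in Bruhat order. -/
noncomputable def BIP (n : ℕ) (v w : Equiv.Perm (Fin n)) : Set (Fin n → ℝ) :=
  convexHull ℝ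
    {x | ∃ u : Equiv.Perm (Fin n), bruhatLE n v u ∧ bruhatLE n u w ∧ x = permPoint n u}

/-- A face of a polytope `P`: a convex extreme subset of `P`. -/
def IsFaceOf {E : Type*} [AddCommGroup E] [Module ℝ E] (P F : Set E) : Prop :=
  IsExtreme ℝ P F ∧ Convex ℝ F

/-- Combinatorial equivalence of two polytopes: an inclusion-preserving (in both
directions) bijection between their face lattices. -/
def CombEquiv {E F : Type*} [AddCommGroup E] [Module ℝ E] [AddCommGroup F] [Module ℝ F]
    (P : Set E) (Q : Set F) : Prop :=
  ∃ e : {A : Set E // IsFaceOf P A} ≃ {B : Set F // IsFaceOf Q B},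
    ∀ A B : {A : Set E // IsFaceOf P A}, A.1 ⊆ B.1 ↔ (e A).1 ⊆ (e B).1

/-- The transposition `(i, j)` (one-indexed values, `1 ≤ i < j ≤ n`), acting on
`{1, …, n}` represented by `Fin n`; identity for invalid input. -/
def transpPerm (n i j : ℕ) : Equiv.Perm (Fin n) :=
  if h : 1 ≤ i ∧ i < j ∧ j ≤ n then Equiv.swap ⟨i - 1, by omega⟩ ⟨j - 1, by omega⟩ else 1

/-- `T̄(u,[v,w])`: the set of transpositions `(i,j)`, `i < j`, with
`u < u·(i,j) ≤ w` and `ℓ(u·(i,j)) = ℓ(u) + 1`. -/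
def upperT (n : ℕ) (u v w : Equiv.Perm (Fin n)) : Set (ℕ × ℕ) :=
  {p | 1 ≤ p.1 ∧ p.1 < p.2 ∧ p.2 ≤ n ∧
    bruhatLT n u (u * transpPerm n p.1 p.2) ∧ bruhatLE n (u * transpPerm n p.1 p.2) w ∧
    permLen n (u * transpPerm n p.1 p.2) = permLen n u + 1}

/-- `T̲(u,[v,w])`: the set of transpositions `(i,j)`, `i < j`, with
`v ≤ u·(i,j) < u` and `ℓ(u·(i,j)) = ℓ(u) - 1`. -/
def lowerT (n : ℕ) (u v w : Equiv.Perm (Fin n)) : Set (ℕ × ℕ) :=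
  {p | 1 ≤ p.1 ∧ p.1 < p.2 ∧ p.2 ≤ n ∧
    bruhatLE n v (u * transpPerm n p.1 p.2) ∧ bruhatLT n (u * transpPerm n p.1 p.2) u ∧
    permLen n (u * transpPerm n p.1 p.2) + 1 = permLen n u}

/-- The permutohedron `Perm₂ ⊂ ℝ³`, a hexagon. -/
noncomputable def Perm2Hex : Set (Fin 3 → ℝ) :=
  convexHull ℝ {x | ∃ σ : Equiv.Perm (Fin 3), x = permPoint 3 σ}

/-- The action of `s_r` on one-indexed letters: swaps `r` and `r + 1`. -/
def srNat (r x : ℕ) : ℕ := if x = r then r + 1 else if x = r + 1 then r else x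


namespace BIPproof

open Equiv

/-- explicit 321 occurrence -/
def o3 {n : ℕ} (w : Perm (Fin n)) (a b c : Fin n) : Prop :=
  a < b ∧ b < c ∧ w c < w b ∧ w b < w a

/-- explicit 3412 occurrence -/
def o4 {n : ℕ} (w : Perm (Fin n)) (a b c d : Fin n) : Prop :=
  a < b ∧ b < c ∧ c < d ∧ w c < w d ∧ w d < w a ∧ w a < w b

/-- at most one occurrence in total -/
structure HH {n : ℕ} (w : Perm (Fin n)) : Prop where
  h3 : ∀ a b c a' b' c', o3 w a b c → o3 w a' b' c' → a = a' ∧ b = b' ∧ c = c'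
  h4 : ∀ a b c d a' b' c' d', o4 w a b c d → o4 w a' b' c' d' →
    a = a' ∧ b = b' ∧ c = c' ∧ d = d'
  h34 : ∀ a b c a' b' c' d', o3 w a b c → o4 w a' b' c' d' → False

lemma occ_of_o3 {n : ℕ} {w : Perm (Fin n)} {a b c : Fin n} (h : o3 w a b c) :
    IsPatternOcc w pattern321 ![a, b, c] := by
  obtain ⟨h1, h2, h3, h4⟩ := h
  constructor
  · intro x y hxy
    fin_cases x <;> fin_cases y <;> simp_all <;> omega
  · intro x y
    fin_cases x <;> fin_cases y <;> simp [pattern321, Equiv.swap_apply_def] <;> omega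

lemma occ_of_o4 {n : ℕ} {w : Perm (Fin n)} {a b c d : Fin n} (h : o4 w a b c d) :
    IsPatternOcc w pattern3412 ![a, b, c, d] := by
  obtain ⟨h1, h2, h3, h4, h5, h6⟩ := h
  constructor
  · intro x y hxy
    fin_cases x <;> fin_cases y <;> simp_all <;> omega
  · intro x y
    fin_cases x <;> fin_cases y <;> simp [pattern3412, Equiv.swap_apply_def] <;> omega

lemma HH_of {n : ℕ} {w : Perm (Fin n)}
    (h : numOcc w pattern321 + numOcc w pattern3412 = 1) : HH w := by
  have key : ∀ {k : ℕ} (p : Perm (Fin k)) (j j' : Fin k → Fin n), IsPatternOcc w p j →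
      IsPatternOcc w p j' → numOcc w p ≤ 1 → j = j' := by
    intro k p j j' hj hj' hle
    unfold numOcc at hle
    exact (Set.ncard_le_one (Set.toFinite _)).1 hle j hj j' hj'
  have pos : ∀ {k : ℕ} (p : Perm (Fin k)) (j : Fin k → Fin n), IsPatternOcc w p j →
      1 ≤ numOcc w p := by
    intro k p j hj
    unfold numOcc
    exact (Set.ncard_pos (Set.toFinite _)).2 ⟨j, hj⟩
  constructor
  · intro a b c a' b' c' h1 h2
    have := key _ _ _ (occ_of_o3 h1) (occ_of_o3 h2) (by omega)
    exact ⟨congrFun this 0, congrFun this 1, congrFun this 2⟩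
  · intro a b c d a' b' c' d' h1 h2
    have := key _ _ _ (occ_of_o4 h1) (occ_of_o4 h2) (by omega)
    exact ⟨congrFun this 0, congrFun this 1, congrFun this 2, congrFun this 3⟩
  · intro a b c a' b' c' d' h1 h2
    have := pos _ _ (occ_of_o3 h1)
    have := pos _ _ (occ_of_o4 h2)
    omega

lemma o3_inv {n : ℕ} {w : Perm (Fin n)} {a b c : Fin n} (h : o3 w⁻¹ a b c) :
    o3 w (w⁻¹ c) (w⁻¹ b) (w⁻¹ a) := by
  obtain ⟨h1, h2, h3, h4⟩ := h
  refine ⟨h3, h4, ?_, ?_⟩ <;> simpa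

lemma o4_inv {n : ℕ} {w : Perm (Fin n)} {a b c d : Fin n} (h : o4 w⁻¹ a b c d) :
    o4 w (w⁻¹ c) (w⁻¹ d) (w⁻¹ a) (w⁻¹ b) := by
  obtain ⟨h1, h2, h3, h4, h5, h6⟩ := h
  refine ⟨h4, h5, h6, ?_, ?_, ?_⟩ <;> simpa

lemma HH.inv {n : ℕ} {w : Perm (Fin n)} (h : HH w) : HH w⁻¹ := by
  constructor
  · intro a b c a' b' c' h1 h2
    have := h.h3 _ _ _ _ _ _ (o3_inv h1) (o3_inv h2)
    simp only [EmbeddingLike.apply_eq_iff_eq] at this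
    tauto
  · intro a b c d a' b' c' d' h1 h2
    have := h.h4 _ _ _ _ _ _ _ _ (o4_inv h1) (o4_inv h2)
    simp only [EmbeddingLike.apply_eq_iff_eq] at this
    tauto
  · intro a b c a' b' c' d' h1 h2
    exact h.h34 _ _ _ _ _ _ _ (o3_inv h1) (o4_inv h2)

/-- right-peelable at positions `a, b = a + 1` -/
def RP {n : ℕ} (w : Perm (Fin n)) (a b : Fin n) : Prop :=
  a.val + 1 = b.val ∧ w b < w a ∧
    (((∀ k, k < a → w k = k) ∧ w b = a) ∨ ((∀ k, b < k → w k = k) ∧ w a = b))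

lemma RP.pres {n : ℕ} {w : Perm (Fin n)} {a b : Fin n} (h : RP w a b) (k : Fin n) (hk : k ≤ a) :
    (w * swap a b) k ≤ a := by
  obtain ⟨hab, hlt, h | h⟩ := h
  · rcases hk.lt_or_eq with h1 | h1
    · rw [Perm.mul_apply, swap_apply_of_ne_of_ne (by omega) (by omega), h.1 k h1]; exact hk
    · subst h1; simp [h.2]
  · by_contra hc
    push Not at hc
    have : b < (w * swap a b) k ∨ (w * swap a b) k = b := by omega
    rcases this with h1 | h1
    · have h2 := h.1 _ h1
      rw [Perm.mul_apply] at h2 h1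
      have h3 := w.injective h2
      have : swap a b k ≤ b := by
        rw [swap_apply_def]; split_ifs <;> omega
      omega
    · have h3 : swap a b k = a := w.injective (h1.trans h.2.symm)
      have h4 : k = b := by
        have h5 := congrArg (swap a b) h3
        rwa [swap_apply_self, swap_apply_left] at h5
      omega

lemma RP.nonmov {n : ℕ} {w : Perm (Fin n)} {a b : Fin n} (h : RP w a b) :
    (∀ k, k ≤ a → (w * swap a b) k = k) ∨ (∀ k, b ≤ k → (w * swap a b) k = k) := by
  obtain ⟨hab, hlt, h | h⟩ := h
  · left
    intro k hk
    rcases hk.lt_or_eq with h1 | h1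
    · rw [Perm.mul_apply, swap_apply_of_ne_of_ne (by omega) (by omega), h.1 k h1]
    · subst h1; simp [h.2]
  · right
    intro k hk
    rcases hk.lt_or_eq with h1 | h1
    · rw [Perm.mul_apply, swap_apply_of_ne_of_ne (by omega) (by omega), h.1 k h1]
    · subst h1; simp [h.2]

lemma swap_lt_low {n : ℕ} {a b : Fin n} (hab : a.val + 1 = b.val) {x y : Fin n}
    (hx : a < x) (hxy : x < y) : swap a b x < swap a b y := by
  simp only [swap_apply_def]; split_ifs <;> omega

lemma swap_lt_high {n : ℕ} {a b : Fin n} (hab : a.val + 1 = b.val) {x y : Fin n}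
    (hy : y < b) (hxy : x < y) : swap a b x < swap a b y := by
  simp only [swap_apply_def]; split_ifs <;> omega

lemma o3_low {n : ℕ} {w : Perm (Fin n)} {a : Fin n} (h : ∀ k, k ≤ a → w k = k) {x y z : Fin n}
    (ho : o3 w x y z) : a < x := by
  obtain ⟨h1, h2, h3, h4⟩ := ho
  by_contra hc
  push Not at hc
  have e1 := h _ hc
  have : w y ≤ a := by omega
  have := w.injective (h _ this)
  have : w z ≤ a := by omega
  have := w.injective (h _ this)
  omega

lemma o4_low {n : ℕ} {w : Perm (Fin n)} {a : Fin n} (h : ∀ k, k ≤ a → w k = k) {x y z t : Fin n}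
    (ho : o4 w x y z t) : a < x := by
  obtain ⟨h1, h2, h3, h4, h5, h6⟩ := ho
  by_contra hc
  push Not at hc
  have e1 := h _ hc
  have : w z ≤ a := by omega
  have := w.injective (h _ this)
  omega

lemma o3_high {n : ℕ} {w : Perm (Fin n)} {b : Fin n} (h : ∀ k, b ≤ k → w k = k) {x y z : Fin n}
    (ho : o3 w x y z) : z < b := by
  obtain ⟨h1, h2, h3, h4⟩ := ho
  by_contra hc
  push Not at hc
  have e1 := h _ hc
  have : b ≤ w y := by omega
  have := w.injective (h _ this)
  omega

lemma o4_high {n : ℕ} {w : Perm (Fin n)} {b : Fin n} (h : ∀ k, b ≤ k → w k = k) {x y z t : Fin n}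
    (ho : o4 w x y z t) : t < b := by
  obtain ⟨h1, h2, h3, h4, h5, h6⟩ := ho
  by_contra hc
  push Not at hc
  have e1 := h _ hc
  have : b ≤ w y := by omega
  have := w.injective (h _ this)
  omega

lemma RP.o3 {n : ℕ} {w : Perm (Fin n)} {a b : Fin n} (h : RP w a b) {x y z : Fin n}
    (ho : o3 (w * swap a b) x y z) : o3 w (swap a b x) (swap a b y) (swap a b z) := by
  have hab := h.1
  rcases h.nonmov with h1 | h1
  · have hl := o3_low h1 ho
    obtain ⟨q1, q2, q3, q4⟩ := ho
    exact ⟨swap_lt_low hab hl q1, swap_lt_low hab (hl.trans q1) q2, q3, q4⟩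
  · have hl := o3_high h1 ho
    obtain ⟨q1, q2, q3, q4⟩ := ho
    exact ⟨swap_lt_high hab (q2.trans hl) q1, swap_lt_high hab hl q2, q3, q4⟩

lemma RP.o4 {n : ℕ} {w : Perm (Fin n)} {a b : Fin n} (h : RP w a b) {x y z t : Fin n}
    (ho : o4 (w * swap a b) x y z t) :
    o4 w (swap a b x) (swap a b y) (swap a b z) (swap a b t) := by
  have hab := h.1
  rcases h.nonmov with h1 | h1
  · have hl := o4_low h1 ho
    obtain ⟨q1, q2, q3, q4, q5, q6⟩ := ho
    exact ⟨swap_lt_low hab hl q1, swap_lt_low hab (hl.trans q1) q2,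
      swap_lt_low hab (hl.trans (q1.trans q2)) q3, q4, q5, q6⟩
  · have hl := o4_high h1 ho
    obtain ⟨q1, q2, q3, q4, q5, q6⟩ := ho
    exact ⟨swap_lt_high hab ((q2.trans q3).trans hl) q1, swap_lt_high hab (q3.trans hl) q2,
      swap_lt_high hab hl q3, q4, q5, q6⟩

lemma RP.HH {n : ℕ} {w : Perm (Fin n)} {a b : Fin n} (h : RP w a b) (hh : HH w) :
    HH (w * swap a b) := by
  constructor
  · intro x y z x' y' z' h1 h2
    have := hh.h3 _ _ _ _ _ _ (h.o3 h1) (h.o3 h2)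
    simp only [EmbeddingLike.apply_eq_iff_eq] at this
    tauto
  · intro x y z t x' y' z' t' h1 h2
    have := hh.h4 _ _ _ _ _ _ _ _ (h.o4 h1) (h.o4 h2)
    simp only [EmbeddingLike.apply_eq_iff_eq] at this
    tauto
  · intro x y z x' y' z' t' h1 h2
    exact hh.h34 _ _ _ _ _ _ _ (h.o3 h1) (h.o4 h2)

lemma low_end {n : ℕ} {w : Perm (Fin n)} (hh : HH w) (hw : w ≠ 1)
    (hr : ∀ a b, ¬ RP w a b) (hl : ∀ a b, ¬ RP w⁻¹ a b) :
    ∃ p p1 : Fin n, p.val + 1 = p1.val ∧ (∀ k, k < p → w k = k) ∧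
      ((w p1 = p1 ∧ o3 w p p1 (w⁻¹ p)) ∨ o4 w p p1 (w⁻¹ p) (w⁻¹ p1)) := by
  have hex : ∃ p, w p ≠ p ∧ ∀ k, k < p → w k = k := by
    have h0 : ∃ p, w p ≠ p := by
      by_contra hc
      push Not at hc
      exact hw (Equiv.ext hc)
    obtain ⟨p, hp, hm⟩ := WellFounded.has_min (wellFounded_lt (α := Fin n)) {p | w p ≠ p} h0
    refine ⟨p, hp, fun k hk => ?_⟩
    by_contra hc
    exact hm k hc hk
  obtain ⟨p, hp, hm⟩ := hex
  have hm' : ∀ k, k < p → w⁻¹ k = k := fun k hk => by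
    rw [Perm.inv_eq_iff_eq]; exact (hm k hk).symm
  have hwp : p < w p := by
    by_contra hc
    have h1 : w p < p := by omega
    exact absurd (w.injective (hm _ h1)) (by omega)
  have hip : p < w⁻¹ p := by
    by_contra hc
    have h0 : w⁻¹ p ≠ p := fun h => hp (Perm.inv_eq_iff_eq.1 h).symm
    have h1 : w⁻¹ p < p := by omega
    exact absurd (w⁻¹.injective (hm' _ h1)) (by omega)
  have hn : p.val + 1 < n := by have := (w p).2; omega
  obtain ⟨p1, hp1⟩ : ∃ p1 : Fin n, p.val + 1 = p1.val := ⟨⟨p.val + 1, hn⟩, rfl⟩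
  have e1 : w (w⁻¹ p) = p := by simp
  have e2 : w (w⁻¹ p1) = p1 := by simp
  have a1 : w p1 ≠ p := fun h => hr p p1 ⟨hp1, by omega, Or.inl ⟨hm, h⟩⟩
  have a2 : w p ≠ p1 := fun h => by
    have h' : w⁻¹ p1 = p := by rw [← h]; simp
    exact hl p p1 ⟨hp1, by omega, Or.inl ⟨hm', h'⟩⟩
  have b1 : p1 ≠ w⁻¹ p := fun h => a1 (by rw [h]; exact e1)
  have c1 : p1 ≤ w p1 := by
    by_contra hc
    rcases lt_or_ge (w p1) p with h1 | h1
    · exact absurd (w.injective (hm _ h1)) (by omega)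
    · omega
  refine ⟨p, p1, hp1, hm, ?_⟩
  rcases eq_or_ne (w p1) p1 with h | h
  · left
    exact ⟨h, by omega, by omega, by omega, by omega⟩
  right
  have c2 : p1 < w⁻¹ p1 := by
    by_contra hc
    have : w⁻¹ p1 ≠ p1 := fun h' => h (Perm.inv_eq_iff_eq.1 h').symm
    rcases lt_or_ge (w⁻¹ p1) p with h1 | h1
    · exact absurd (w⁻¹.injective (hm' _ h1)) (by omega)
    · have h2 : w⁻¹ p1 = p := by omega
      exact a2 (by rw [← h2]; exact e2)
  have d1 : w p < w p1 := by
    by_contra hc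
    have : w p ≠ w p1 := fun h => absurd (w.injective h) (by omega)
    have o1 : o3 w p p1 (w⁻¹ p) := ⟨by omega, by omega, by omega, by omega⟩
    have o2 : o3 w p p1 (w⁻¹ p1) := ⟨by omega, by omega, by omega, by omega⟩
    have := (hh.h3 _ _ _ _ _ _ o1 o2).2.2
    exact absurd (w⁻¹.injective this) (by omega)
  have d2 : w⁻¹ p < w⁻¹ p1 := by
    by_contra hc
    have : w⁻¹ p ≠ w⁻¹ p1 := fun h => absurd (w⁻¹.injective h) (by omega)
    have o1 : o3 w p (w⁻¹ p1) (w⁻¹ p) := ⟨by omega, by omega, by omega, by omega⟩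
    have o2 : o3 w p1 (w⁻¹ p1) (w⁻¹ p) := ⟨by omega, by omega, by omega, by omega⟩
    have := (hh.h3 _ _ _ _ _ _ o1 o2).1
    omega
  exact ⟨by omega, by omega, by omega, by omega, by omega, by omega⟩

lemma high_end {n : ℕ} {w : Perm (Fin n)} (hh : HH w) (hw : w ≠ 1)
    (hr : ∀ a b, ¬ RP w a b) (hl : ∀ a b, ¬ RP w⁻¹ a b) :
    ∃ p p1 : Fin n, p1.val + 1 = p.val ∧ (∀ k, p < k → w k = k) ∧
      ((w p1 = p1 ∧ o3 w (w⁻¹ p) p1 p) ∨ o4 w (w⁻¹ p1) (w⁻¹ p) p1 p) := by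
  have hex : ∃ p, w p ≠ p ∧ ∀ k, p < k → w k = k := by
    have h0 : ∃ p, w p ≠ p := by
      by_contra hc
      push Not at hc
      exact hw (Equiv.ext hc)
    obtain ⟨p, hp, hm⟩ := WellFounded.has_min (wellFounded_gt (α := Fin n)) {p | w p ≠ p} h0
    refine ⟨p, hp, fun k hk => ?_⟩
    by_contra hc
    exact hm k hc hk
  obtain ⟨p, hp, hm⟩ := hex
  have hm' : ∀ k, p < k → w⁻¹ k = k := fun k hk => by
    rw [Perm.inv_eq_iff_eq]; exact (hm k hk).symm
  have hwp : w p < p := by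
    by_contra hc
    have h1 : p < w p := by omega
    exact absurd (w.injective (hm _ h1)) (by omega)
  have hip : w⁻¹ p < p := by
    by_contra hc
    have h0 : w⁻¹ p ≠ p := fun h => hp (Perm.inv_eq_iff_eq.1 h).symm
    have h1 : p < w⁻¹ p := by omega
    exact absurd (w⁻¹.injective (hm' _ h1)) (by omega)
  obtain ⟨p1, hp1⟩ : ∃ p1 : Fin n, p1.val + 1 = p.val :=
    ⟨⟨p.val - 1, by omega⟩, by simp only; omega⟩
  have e1 : w (w⁻¹ p) = p := by simp
  have e2 : w (w⁻¹ p1) = p1 := by simp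
  have a1 : w p1 ≠ p := fun h => hr p1 p ⟨hp1, by omega, Or.inr ⟨hm, h⟩⟩
  have a2 : w p ≠ p1 := fun h => by
    have h' : w⁻¹ p1 = p := by rw [← h]; simp
    exact hl p1 p ⟨hp1, by omega, Or.inr ⟨hm', h'⟩⟩
  have b1 : p1 ≠ w⁻¹ p := fun h => a1 (by rw [h]; exact e1)
  have c1 : w p1 ≤ p1 := by
    by_contra hc
    rcases lt_or_ge p (w p1) with h1 | h1
    · exact absurd (w.injective (hm _ h1)) (by omega)
    · omega
  refine ⟨p, p1, hp1, hm, ?_⟩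
  rcases eq_or_ne (w p1) p1 with h | h
  · left
    exact ⟨h, by omega, by omega, by omega, by omega⟩
  right
  have c2 : w⁻¹ p1 < p1 := by
    by_contra hc
    have : w⁻¹ p1 ≠ p1 := fun h' => h (Perm.inv_eq_iff_eq.1 h').symm
    rcases lt_or_ge p (w⁻¹ p1) with h1 | h1
    · exact absurd (w⁻¹.injective (hm' _ h1)) (by omega)
    · have h2 : w⁻¹ p1 = p := by omega
      exact a2 (by rw [← h2]; exact e2)
  have d1 : w p1 < w p := by
    by_contra hc
    have : w p ≠ w p1 := fun h => absurd (w.injective h) (by omega)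
    have o1 : o3 w (w⁻¹ p) p1 p := ⟨by omega, by omega, by omega, by omega⟩
    have o2 : o3 w (w⁻¹ p1) p1 p := ⟨by omega, by omega, by omega, by omega⟩
    have := (hh.h3 _ _ _ _ _ _ o1 o2).1
    exact absurd (w⁻¹.injective this) (by omega)
  have d2 : w⁻¹ p1 < w⁻¹ p := by
    by_contra hc
    have : w⁻¹ p ≠ w⁻¹ p1 := fun h => absurd (w⁻¹.injective h) (by omega)
    have o1 : o3 w (w⁻¹ p) (w⁻¹ p1) p := ⟨by omega, by omega, by omega, by omega⟩
    have o2 : o3 w (w⁻¹ p) (w⁻¹ p1) p1 := ⟨by omega, by omega, by omega, by omega⟩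
    have := (hh.h3 _ _ _ _ _ _ o1 o2).2.2
    omega
  exact ⟨by omega, by omega, by omega, by omega, by omega, by omega⟩

lemma core {n : ℕ} {w : Perm (Fin n)} (hh : HH w)
    (hr : ∀ a b, ¬ RP w a b) (hl : ∀ a b, ¬ RP w⁻¹ a b) : w⁻¹ = w := by
  by_cases hw : w = 1
  · simp [hw]
  obtain ⟨p, p1, hp1, hm, hp⟩ := low_end hh hw hr hl
  obtain ⟨q, q1, hq1, hM, hq⟩ := high_end hh hw hr hl
  suffices h : ∀ x, w (w x) = x by
    ext x : 1
    rw [Perm.inv_eq_iff_eq, h]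
  rcases hp with ⟨hpp, hp⟩ | hp <;> rcases hq with ⟨hqq, hq⟩ | hq
  · obtain ⟨h1, h2, h3⟩ := hh.h3 _ _ _ _ _ _ hp hq
    have e1 : w q = p := by rw [← h3]; simp
    have e2 : w p = q := by rw [h1]; simp
    intro x
    rcases lt_trichotomy x p with h | h | h
    · rw [hm x h, hm x h]
    · rw [h, e2, e1]
    rcases lt_trichotomy x q with h' | h' | h'
    · have : x = p1 := by omega
      rw [this, hpp, hpp]
    · rw [h', e1, e2]
    · rw [hM x h', hM x h']
  · exact (hh.h34 _ _ _ _ _ _ _ hp hq).elim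
  · exact (hh.h34 _ _ _ _ _ _ _ hq hp).elim
  · obtain ⟨h1, h2, h3, h4⟩ := hh.h4 _ _ _ _ _ _ _ _ hp hq
    have e1 : w q1 = p := by rw [← h3]; simp
    have e2 : w q = p1 := by rw [← h4]; simp
    have e3 : w p = q1 := by rw [h1]; simp
    have e4 : w p1 = q := by rw [h2]; simp
    intro x
    by_cases k1 : x = p
    · rw [k1, e3, e1]
    by_cases k2 : x = p1
    · rw [k2, e4, e2]
    by_cases k3 : x = q
    · rw [k3, e2, e4]
    by_cases k4 : x = q1
    · rw [k4, e1, e3]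
    rcases lt_or_ge x p with h | h
    · rw [hm x h, hm x h]
    rcases lt_or_ge q x with h' | h'
    · rw [hM x h', hM x h']
    exfalso
    have i1 : w x ≠ p := fun h => k4 (w.injective (h.trans e1.symm))
    have i2 : w x ≠ q1 := fun h => k1 (w.injective (h.trans e3.symm))
    have i3 : w x ≠ q := fun h => k2 (w.injective (h.trans e4.symm))
    have l1 : p < w x := by
      by_contra hc
      have h6 : w x < p := by omega
      have := w.injective (hm _ h6)
      omega
    have l2 : w x < q := by
      by_contra hc
      have h6 : q < w x := by omega
      have := w.injective (hM _ h6)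
      omega
    exact hh.h34 p x q1 _ _ _ _ ⟨by omega, by omega, by omega, by omega⟩ hp

/-! Bruhat order via ranks -/

/-- rank numbers -/
def rk {n : ℕ} (u : Perm (Fin n)) (i m : ℕ) : ℕ :=
  ∑ k : Fin n, if k.val < i ∧ m ≤ (u k).val then 1 else 0

/-- rank order -/
def rle {n : ℕ} (u w : Perm (Fin n)) : Prop := ∀ i m, rk u i m ≤ rk w i m

lemma rle_trans {n : ℕ} {u v w : Perm (Fin n)} (h : rle u v) (h' : rle v w) : rle u w :=
  fun i m => (h i m).trans (h' i m)

lemma rk_succ {n : ℕ} (u : Perm (Fin n)) (a : Fin n) (m : ℕ) :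
    rk u (a.val + 1) m = rk u a.val m + if m ≤ (u a).val then 1 else 0 := by
  unfold rk
  have : (if m ≤ (u a).val then 1 else 0) =
      ∑ k : Fin n, if k = a then (if m ≤ (u k).val then 1 else 0) else 0 := by
    rw [Finset.sum_ite_eq' Finset.univ a]; simp
  rw [this, ← Finset.sum_add_distrib]
  refine Finset.sum_congr rfl fun k _ => ?_
  by_cases hk : k = a
  · subst hk; simp
  · have : k.val ≠ a.val := fun h => hk (Fin.ext h)
    have e : k.val < a.val + 1 ↔ k.val < a.val := by omega
    simp [hk, e]

lemma rk_swap {n : ℕ} (u : Perm (Fin n)) {a b : Fin n} (hab : a.val + 1 = b.val) (i m : ℕ)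
    (hi : i ≠ b.val) : rk (u * swap a b) i m = rk u i m := by
  unfold rk
  rw [← Equiv.sum_comp (swap a b)]
  refine Finset.sum_congr rfl fun k _ => ?_
  have : (swap a b k).val < i ↔ k.val < i := by
    rw [swap_apply_def]; split_ifs with h1 h2
    · subst h1; omega
    · subst h2; omega
    · rfl
  simp [this]

lemma rk_swap_mid {n : ℕ} (u : Perm (Fin n)) {a b : Fin n} (hab : a.val + 1 = b.val) (m : ℕ) :
    rk (u * swap a b) b.val m = rk u a.val m + if m ≤ (u b).val then 1 else 0 := by
  rw [← hab, rk_succ, rk_swap u hab _ _ (by omega)]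
  simp

lemma rk_mid {n : ℕ} (u : Perm (Fin n)) {a b : Fin n} (hab : a.val + 1 = b.val) (m : ℕ) :
    rk u b.val m = rk u a.val m + if m ≤ (u a).val then 1 else 0 := by
  rw [← hab, rk_succ]

lemma rle_asc {n : ℕ} {w : Perm (Fin n)} {a b : Fin n} (hab : a.val + 1 = b.val)
    (h : w a < w b) : rle w (w * swap a b) := by
  intro i m
  by_cases hi : i = b.val
  · subst hi
    rw [rk_swap_mid w hab, rk_mid w hab]
    split_ifs <;> omega
  · rw [rk_swap w hab i m hi]

lemma rle_desc {n : ℕ} {w : Perm (Fin n)} {a b : Fin n} (hab : a.val + 1 = b.val)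
    (h : w b < w a) : rle (w * swap a b) w := by
  have := rle_asc (w := w * swap a b) hab (by simpa using h)
  rwa [mul_assoc, swap_mul_self, mul_one] at this

lemma lift1 {n : ℕ} {u w : Perm (Fin n)} {a b : Fin n} (hab : a.val + 1 = b.val)
    (h : w b < w a) (hu : u b < u a) (hr : rle u w) : rle (u * swap a b) (w * swap a b) := by
  intro i m
  by_cases hi : i = b.val
  · subst hi
    rw [rk_swap_mid w hab, rk_swap_mid u hab]
    have h1 := hr a.val m
    have h2 := hr (b.val + 1) m
    rw [rk_succ, rk_succ, rk_mid u hab, rk_mid w hab] at h2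
    split_ifs at * <;> omega
  · rw [rk_swap w hab i m hi, rk_swap u hab i m hi]
    exact hr i m

lemma lift2 {n : ℕ} {u w : Perm (Fin n)} {a b : Fin n} (hab : a.val + 1 = b.val)
    (h : w b < w a) (hu : u a < u b) (hr : rle u w) : rle u (w * swap a b) := by
  intro i m
  by_cases hi : i = b.val
  · subst hi
    rw [rk_swap_mid w hab, rk_mid u hab]
    have h1 := hr a.val m
    have h2 := hr (b.val + 1) m
    rw [rk_succ, rk_succ, rk_mid u hab, rk_mid w hab] at h2
    split_ifs at * <;> omega
  · rw [rk_swap w hab i m hi]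
    exact hr i m

lemma lift3 {n : ℕ} {u w : Perm (Fin n)} {a b : Fin n} (hab : a.val + 1 = b.val)
    (h : w b < w a) (hr : rle u w) : rle (u * swap a b) w := by
  intro i m
  by_cases hi : i = b.val
  · subst hi
    rw [rk_swap_mid u hab, rk_mid w hab]
    have h1 := hr a.val m
    have h2 := hr (b.val + 1) m
    rw [rk_succ, rk_succ, rk_mid u hab, rk_mid w hab] at h2
    split_ifs at * <;> omega
  · rw [rk_swap u hab i m hi]
    exact hr i m

lemma eq_one_of_le {n : ℕ} {u : Perm (Fin n)} (h : ∀ k, u k ≤ k) : u = 1 := by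
  have hs : ∑ k, ((u k).val) = ∑ k : Fin n, k.val := Equiv.sum_comp u (fun k => k.val)
  have := (Finset.sum_eq_sum_iff_of_le (s := Finset.univ) (f := fun k => (u k).val)
    (g := fun k : Fin n => k.val) (fun k _ => h k)).1 hs
  ext k
  simpa using this k (Finset.mem_univ k)

lemma rle_pres {n : ℕ} {u w : Perm (Fin n)} (hr : rle u w) {i : ℕ}
    (hw : ∀ k : Fin n, k.val < i → (w k).val < i) (k : Fin n) (hk : k.val < i) :
    (u k).val < i := by
  have h1 := hr i i
  have h2 : rk w i i = 0 := by
    unfold rk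
    refine Finset.sum_eq_zero fun k _ => ?_
    rw [if_neg]
    rintro ⟨h3, h4⟩
    have := hw k h3
    omega
  rw [h2] at h1
  have h3 : rk u i i = 0 := by omega
  unfold rk at h3
  rw [Finset.sum_eq_zero_iff] at h3
  have := h3 k (Finset.mem_univ _)
  by_contra hc
  rw [if_pos ⟨hk, by omega⟩] at this
  omega

lemma rle_one {n : ℕ} {u : Perm (Fin n)} (hr : rle u 1) : u = 1 := by
  apply eq_one_of_le
  intro k
  have := rle_pres hr (i := k.val + 1) (fun k hk => by simpa using hk) k (by omega)
  omega

/-- number of inversions -/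
def inv {n : ℕ} (w : Perm (Fin n)) : ℕ :=
  (Finset.univ.filter fun q : Fin n × Fin n => q.1 < q.2 ∧ w q.2 < w q.1).card

lemma swap_ord {n : ℕ} {a b : Fin n} (hab : a.val + 1 = b.val) {x y : Fin n}
    (hxy : x < y) (hne : ¬ (x = a ∧ y = b)) : swap a b x < swap a b y := by
  simp only [swap_apply_def]; split_ifs <;> omega

lemma inv_asc {n : ℕ} {w : Perm (Fin n)} {a b : Fin n} (hab : a.val + 1 = b.val)
    (h : w a < w b) : inv (w * swap a b) = inv w + 1 := by
  unfold inv
  have hmem : (a, b) ∈ Finset.univ.filter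
      fun q : Fin n × Fin n => q.1 < q.2 ∧ (w * swap a b) q.2 < (w * swap a b) q.1 := by
    simp only [Finset.mem_filter, Finset.mem_univ, true_and]
    refine ⟨by omega, by simpa using h⟩
  rw [← Finset.card_erase_add_one hmem]
  congr 1
  refine Finset.card_nbij' (fun q => (swap a b q.1, swap a b q.2))
    (fun q => (swap a b q.1, swap a b q.2)) ?_ ?_ ?_ ?_
  · rintro ⟨x, y⟩ hq
    simp only [Finset.coe_erase, Finset.coe_filter, Finset.mem_univ, true_and, Set.mem_diff,
      Set.mem_setOf_eq, Set.mem_singleton_iff, Prod.mk.injEq] at hq ⊢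
    exact ⟨swap_ord hab hq.1.1 hq.2, hq.1.2⟩
  · rintro ⟨x, y⟩ hq
    simp only [Finset.coe_erase, Finset.coe_filter, Finset.mem_univ, true_and, Set.mem_diff,
      Set.mem_setOf_eq, Set.mem_singleton_iff, Prod.mk.injEq] at hq ⊢
    have hne : ¬ (x = a ∧ y = b) := by
      rintro ⟨rfl, rfl⟩
      omega
    refine ⟨⟨swap_ord hab hq.1 hne, by simpa using hq.2⟩, ?_⟩
    rintro ⟨h1, h2⟩
    have e1 : x = b := by
      have := congrArg (swap a b) h1
      rwa [swap_apply_self, swap_apply_left] at this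
    have e2 : y = a := by
      have := congrArg (swap a b) h2
      rwa [swap_apply_self, swap_apply_right] at this
    omega
  · rintro ⟨x, y⟩ _
    simp
  · rintro ⟨x, y⟩ _
    simp

lemma inv_desc {n : ℕ} {w : Perm (Fin n)} {a b : Fin n} (hab : a.val + 1 = b.val)
    (h : w b < w a) : inv w = inv (w * swap a b) + 1 := by
  have := inv_asc (w := w * swap a b) hab (by simpa using h)
  rwa [mul_assoc, swap_mul_self, mul_one] at this

lemma asc_or_desc {n : ℕ} (w : Perm (Fin n)) {a b : Fin n} (hab : a.val + 1 = b.val) :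
    w a < w b ∨ w b < w a := by
  have : w a ≠ w b := fun h => absurd (w.injective h) (by omega)
  omega

lemma exists_desc {n : ℕ} {w : Perm (Fin n)} (hw : w ≠ 1) :
    ∃ a b : Fin n, a.val + 1 = b.val ∧ w b < w a := by
  by_contra hc
  push Not at hc
  apply hw
  have mono : ∀ (d : ℕ) (x y : Fin n), x.val + d = y.val → w x ≤ w y := by
    intro d
    induction d with
    | zero => intro x y h; rw [Fin.ext (a := x) (b := y) (by omega)]
    | succ d ih =>
      intro x y h
      have hlt : x.val + d < n := by omega
      exact (ih x ⟨x.val + d, hlt⟩ rfl).trans (hc ⟨x.val + d, hlt⟩ y (by simp only; omega))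
  have mono' : StrictMono w := by
    intro x y hxy
    have h1 := mono (y.val - x.val) x y (by omega)
    exact lt_of_le_of_ne h1 (fun h => absurd (w.injective h) (by omega))
  have h2 : StrictMono (w⁻¹ : Perm (Fin n)) := by
    intro x y hxy
    by_contra hcc
    push Not at hcc
    have := mono'.monotone hcc
    simp at this
    omega
  have h3 : w⁻¹ = 1 := by
    apply eq_one_of_le
    intro k
    have := mono'.le_apply (x := w⁻¹ k)
    simpa using this
  simpa using h3

lemma simpleT_cases (n i : ℕ) : simpleT n i = 1 ∨
    ∃ a b : Fin n, a.val + 1 = b.val ∧ b.val = i ∧ simpleT n i = swap a b := by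
  unfold simpleT
  split_ifs with h
  · right
    exact ⟨⟨i - 1, by omega⟩, ⟨i, h.2⟩, by simp only; omega, rfl, rfl⟩
  · left; rfl

lemma simpleT_eq {n : ℕ} {a b : Fin n} (hab : a.val + 1 = b.val) :
    simpleT n b.val = swap a b := by
  unfold simpleT
  rw [dif_pos ⟨by omega, b.2⟩]
  congr 1
  ext; simp only; omega

lemma inv_one {n : ℕ} : inv (1 : Perm (Fin n)) = 0 := by
  unfold inv
  rw [Finset.card_eq_zero, Finset.filter_eq_empty_iff]
  rintro ⟨x, y⟩ _ ⟨h1, h2⟩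
  simp only [Perm.coe_one, id_eq] at h1 h2
  omega

lemma inv_simple {n : ℕ} (w : Perm (Fin n)) (i : ℕ) : inv (w * simpleT n i) ≤ inv w + 1 := by
  rcases simpleT_cases n i with h | ⟨a, b, hab, -, h⟩
  · rw [h, mul_one]; omega
  · rw [h]
    rcases asc_or_desc w hab with h1 | h1
    · rw [inv_asc hab h1]
    · have := inv_desc hab h1
      omega

lemma inv_prod {n : ℕ} (l : List ℕ) : inv ((l.map (simpleT n)).prod) ≤ l.length := by
  induction l using List.reverseRecOn with
  | nil => simp [inv_one]
  | append_singleton l i ih =>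
    have := inv_simple ((l.map (simpleT n)).prod) i
    simp only [List.map_append, List.map_cons, List.map_nil, List.prod_append, List.prod_cons,
      List.prod_nil, mul_one, List.length_append, List.length_cons, List.length_nil]
    omega

lemma exists_word {n : ℕ} : ∀ (N : ℕ) (w : Perm (Fin n)), inv w = N →
    ∃ l : List ℕ, l.length = N ∧ (l.map (simpleT n)).prod = w := by
  intro N
  induction N with
  | zero =>
    intro w hw
    have : w = 1 := by
      by_contra hc
      obtain ⟨a, b, hab, h⟩ := exists_desc hc
      have := inv_desc hab h
      omega
    exact ⟨[], rfl, by simp [this]⟩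
  | succ N ih =>
    intro w hw
    have hc : w ≠ 1 := by
      rintro rfl
      rw [inv_one] at hw
      omega
    obtain ⟨a, b, hab, h⟩ := exists_desc hc
    have h1 := inv_desc hab h
    obtain ⟨l, hl, hp⟩ := ih (w * swap a b) (by omega)
    refine ⟨l ++ [b.val], by simp [hl], ?_⟩
    simp [hp, simpleT_eq hab, mul_assoc]

lemma permLen_eq {n : ℕ} (w : Perm (Fin n)) : permLen n w = inv w := by
  unfold permLen
  apply le_antisymm
  · exact Nat.sInf_le (exists_word _ w rfl)
  · refine le_csInf ⟨_, exists_word _ w rfl⟩ ?_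
    rintro l ⟨word, h1, h2⟩
    rw [← h1, ← h2]
    exact inv_prod word

lemma reduced_append {n : ℕ} {l : List ℕ} {i : ℕ} {w : Perm (Fin n)}
    (h : IsReducedWord n (l ++ [i]) w) : ∃ a b : Fin n, a.val + 1 = b.val ∧ b.val = i ∧
      w b < w a ∧ IsReducedWord n l (w * swap a b) := by
  obtain ⟨h1, h2⟩ := h
  rw [permLen_eq] at h2
  simp only [List.map_append, List.map_cons, List.map_nil, List.prod_append, List.prod_cons,
      List.prod_nil, mul_one, List.length_append, List.length_cons, List.length_nil] at h1 h2
  have h3 := inv_prod (n := n) l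
  rcases simpleT_cases n i with h | ⟨a, b, hab, hb, h⟩
  · rw [h, mul_one] at h1
    rw [h1] at h3
    omega
  · rw [h] at h1
    have h5 : w * swap a b = (l.map (simpleT n)).prod := by
      rw [← h1, mul_assoc, swap_mul_self, mul_one]
    rw [← h5] at h3
    have h4 : w b < w a := by
      rcases asc_or_desc w hab with h4 | h4
      · have := inv_asc hab h4
        omega
      · exact h4
    refine ⟨a, b, hab, hb, h4, h5.symm, ?_⟩
    rw [permLen_eq]
    have := inv_desc hab h4
    omega

lemma append_reduced {n : ℕ} {l : List ℕ} {w : Perm (Fin n)} {a b : Fin n}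
    (hab : a.val + 1 = b.val) (hw : w b < w a) (h : IsReducedWord n l (w * swap a b)) :
    IsReducedWord n (l ++ [b.val]) w := by
  obtain ⟨h1, h2⟩ := h
  rw [permLen_eq] at h2
  constructor
  · simp [h1, simpleT_eq hab, mul_assoc]
  · rw [permLen_eq, inv_desc hab hw]
    simp [h2]

lemma sub_rle {n : ℕ} (l : List ℕ) : ∀ (l' : List ℕ) (w : Perm (Fin n)),
    IsReducedWord n l w → l'.Sublist l → rle ((l'.map (simpleT n)).prod) w := by
  induction l using List.reverseRecOn with
  | nil =>
    intro l' w h hs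
    rw [List.sublist_nil] at hs
    subst hs
    rw [h.1]
    exact fun i m => le_rfl
  | append_singleton l i ih =>
    intro l' w h hs
    obtain ⟨a, b, hab, hb, hw, hr⟩ := reduced_append h
    rw [List.sublist_append_iff] at hs
    obtain ⟨l1, l2, rfl, hs1, hs2⟩ := hs
    have h1 := rle_trans (ih l1 _ hr hs1) (rle_desc hab hw)
    rw [List.sublist_singleton] at hs2
    rcases hs2 with rfl | rfl
    · simpa using h1
    · have h2 := lift3 hab hw h1
      simpa [← hb, simpleT_eq hab] using h2

lemma rle_bruhat {n : ℕ} : ∀ (N : ℕ) (u w : Perm (Fin n)), inv w = N → rle u w →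
    bruhatLE n u w := by
  intro N
  induction N with
  | zero =>
    intro u w hw hr
    have : w = 1 := by
      by_contra hc
      obtain ⟨a, b, hab, h⟩ := exists_desc hc
      have := inv_desc hab h
      omega
    subst this
    have := rle_one hr
    subst this
    have : IsReducedWord n [] (1 : Perm (Fin n)) := ⟨rfl, by rw [permLen_eq, inv_one]; rfl⟩
    exact ⟨[], [], this, this, List.Sublist.refl _⟩
  | succ N ih =>
    intro u w hw hr
    have hc : w ≠ 1 := by
      rintro rfl
      rw [inv_one] at hw
      omega
    obtain ⟨a, b, hab, h⟩ := exists_desc hc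
    have h1 := inv_desc hab h
    rcases asc_or_desc u hab with hu | hu
    · obtain ⟨l', l, hl', hl, hs⟩ := ih u (w * swap a b) (by omega) (lift2 hab h hu hr)
      exact ⟨l', l ++ [b.val], hl', append_reduced hab h hl,
        hs.trans (List.sublist_append_left _ _)⟩
    · obtain ⟨l', l, hl', hl, hs⟩ := ih (u * swap a b) (w * swap a b) (by omega)
        (lift1 hab h hu hr)
      exact ⟨l' ++ [b.val], l ++ [b.val], append_reduced hab hu hl', append_reduced hab h hl,
        hs.append (List.Sublist.refl _)⟩

lemma bruhat_iff {n : ℕ} (u w : Perm (Fin n)) : bruhatLE n u w ↔ rle u w := by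
  constructor
  · rintro ⟨l', l, hl', hl, hs⟩
    have := sub_rle l l' w hl hs
    rwa [hl'.1] at this
  · exact rle_bruhat _ u w rfl

lemma simpleT_inv (n i : ℕ) : (simpleT n i)⁻¹ = simpleT n i := by
  rcases simpleT_cases n i with h | ⟨a, b, hab, -, h⟩ <;> simp [h]

lemma prod_reverse (n : ℕ) (l : List ℕ) :
    ((l.reverse).map (simpleT n)).prod = ((l.map (simpleT n)).prod)⁻¹ := by
  induction l with
  | nil => simp
  | cons i l ih => simp_all [simpleT_inv]

lemma permLen_inv {n : ℕ} (w : Perm (Fin n)) : permLen n w⁻¹ ≤ permLen n w := by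
  rw [permLen_eq w]
  obtain ⟨l, hl, hp⟩ := exists_word _ w rfl
  refine Nat.sInf_le ⟨l.reverse, by simpa using hl, ?_⟩
  rw [prod_reverse, hp]

lemma permLen_inv' {n : ℕ} (w : Perm (Fin n)) : permLen n w⁻¹ = permLen n w :=
  le_antisymm (permLen_inv w) (by simpa using permLen_inv w⁻¹)

lemma bruhat_inv {n : ℕ} {u w : Perm (Fin n)} (h : bruhatLE n u w) : bruhatLE n u⁻¹ w⁻¹ := by
  obtain ⟨l', l, hl', hl, hs⟩ := h
  refine ⟨l'.reverse, l.reverse, ⟨by rw [prod_reverse, hl'.1], ?_⟩,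
    ⟨by rw [prod_reverse, hl.1], ?_⟩, List.reverse_sublist.2 hs⟩
  · rw [permLen_inv', List.length_reverse, hl'.2]
  · rw [permLen_inv', List.length_reverse, hl.2]

lemma rle_inv {n : ℕ} {u w : Perm (Fin n)} (h : rle u w) : rle u⁻¹ w⁻¹ :=
  (bruhat_iff _ _).1 (bruhat_inv ((bruhat_iff _ _).2 h))

lemma inv_inv {n : ℕ} (w : Perm (Fin n)) : inv w⁻¹ = inv w := by
  rw [← permLen_eq, ← permLen_eq, permLen_inv']

lemma one_rle {n : ℕ} (w : Perm (Fin n)) : rle 1 w := by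
  rw [← bruhat_iff]
  obtain ⟨l, hl, hp⟩ := exists_word _ w rfl
  exact ⟨[], l, ⟨rfl, by rw [permLen_eq, inv_one]; rfl⟩, ⟨hp, by rw [permLen_eq, hl]⟩,
    List.nil_sublist _⟩

/-- lower interval -/
def LL {n : ℕ} (w : Perm (Fin n)) : Set (Perm (Fin n)) := {u | rle u w}

/-! Maximizers -/

/-- maximizers of `g` on `V` -/
def EE {α : Type*} (V : Set α) (g : α → ℝ) : Set α := {u | u ∈ V ∧ ∀ v ∈ V, g v ≤ g u}

lemma EE_union1 {α : Type*} {V : Set α} {φ : α → α} {g : α → ℝ}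
    (h : ∀ u ∈ V, ∃ v ∈ V, g (φ u) < g v) : EE (V ∪ φ '' V) g = EE V g := by
  ext u
  constructor
  · rintro ⟨hu | ⟨v, hv, rfl⟩, hm⟩
    · exact ⟨hu, fun v hv => hm v (Or.inl hv)⟩
    · obtain ⟨x, hx, hlt⟩ := h v hv
      exact absurd (hm x (Or.inl hx)) (not_le.2 hlt)
  · rintro ⟨hu, hm⟩
    refine ⟨Or.inl hu, ?_⟩
    rintro v (hv | ⟨v, hv, rfl⟩)
    · exact hm v hv
    · obtain ⟨x, hx, hlt⟩ := h v hv
      exact hlt.le.trans (hm x hx)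

lemma EE_union2 {α : Type*} {V : Set α} {φ : α → α} {g : α → ℝ}
    (h : ∀ u ∈ V, ∃ v ∈ V, g u < g (φ v)) :
    EE (V ∪ φ '' V) g = φ '' EE V (fun u => g (φ u)) := by
  ext u
  constructor
  · rintro ⟨hu | ⟨v, hv, rfl⟩, hm⟩
    · obtain ⟨x, hx, hlt⟩ := h u hu
      exact absurd (hm (φ x) (Or.inr ⟨x, hx, rfl⟩)) (not_le.2 hlt)
    · exact ⟨v, ⟨hv, fun x hx => hm _ (Or.inr ⟨x, hx, rfl⟩)⟩, rfl⟩
  · rintro ⟨u, ⟨hu, hm⟩, rfl⟩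
    refine ⟨Or.inr ⟨u, hu, rfl⟩, ?_⟩
    rintro v (hv | ⟨v, hv, rfl⟩)
    · obtain ⟨x, hx, hlt⟩ := h v hv
      exact hlt.le.trans (hm x hx)
    · exact hm v hv

lemma EE_union3 {α : Type*} {V : Set α} {φ : α → α} {g : α → ℝ}
    (h : ∀ u ∈ V, ∃ v ∈ V, g u ≤ g (φ v)) (h' : ∀ u ∈ V, ∃ v ∈ V, g (φ u) ≤ g v) :
    EE (V ∪ φ '' V) g = EE V g ∪ φ '' EE V (fun u => g (φ u)) := by
  ext u
  constructor
  · rintro ⟨hu | ⟨v, hv, rfl⟩, hm⟩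
    · exact Or.inl ⟨hu, fun v hv => hm v (Or.inl hv)⟩
    · exact Or.inr ⟨v, ⟨hv, fun x hx => hm _ (Or.inr ⟨x, hx, rfl⟩)⟩, rfl⟩
  · rintro (⟨hu, hm⟩ | ⟨u, ⟨hu, hm⟩, rfl⟩)
    · refine ⟨Or.inl hu, ?_⟩
      rintro v (hv | ⟨v, hv, rfl⟩)
      · exact hm v hv
      · obtain ⟨x, hx, hlt⟩ := h' v hv
        exact hlt.trans (hm x hx)
    · refine ⟨Or.inr ⟨u, hu, rfl⟩, ?_⟩
      rintro v (hv | ⟨v, hv, rfl⟩)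
      · obtain ⟨x, hx, hlt⟩ := h v hv
        exact hlt.trans (hm x hx)
      · exact hm v hv

lemma EE_nonempty {α : Type*} [Finite α] {V : Set α} (hV : V.Nonempty) (g : α → ℝ) :
    (EE V g).Nonempty := by
  obtain ⟨u, hu, h⟩ := Set.exists_max_image V g (Set.toFinite V) hV
  exact ⟨u, hu, h⟩

lemma EE_congr {α : Type*} {V : Set α} {g g' : α → ℝ} (c : ℝ) (h : ∀ u ∈ V, g' u = g u + c) :
    EE V g' = EE V g := by
  ext u
  constructor <;> rintro ⟨hu, hm⟩ <;> refine ⟨hu, fun v hv => ?_⟩ <;> have := hm v hv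
  · rw [h u hu, h v hv] at this; linarith
  · rw [h u hu, h v hv]; linarith

/-- value of a functional -/
noncomputable def val {n : ℕ} (u : Perm (Fin n)) (f : Fin n → ℝ) : ℝ :=
  ∑ k, f k * permPoint n u k

/-- the family of (nonempty) faces as vertex sets -/
def fam {n : ℕ} (V : Set (Perm (Fin n))) : Set (Set (Perm (Fin n))) :=
  {A | ∃ f : Fin n → ℝ, A = EE V (fun u => val u f)}

/-- nonempty subsets of a two-element set -/
abbrev TT := {S : Set Bool // S.Nonempty}

lemma prism {n : ℕ} {V V0 : Set (Perm (Fin n))} {φ : Perm (Fin n) → Perm (Fin n)}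
    (hne : V0.Nonempty) (hφ : Function.Injective φ) (hd : ∀ u ∈ V0, ∀ v ∈ V0, φ u ≠ v)
    (h1 : ∀ B ∈ fam V, ∃ A ∈ fam V0, B = A ∨ B = φ '' A ∨ B = A ∪ φ '' A)
    (h2 : ∀ A ∈ fam V0, A ∈ fam V ∧ φ '' A ∈ fam V ∧ A ∪ φ '' A ∈ fam V) :
    Nonempty (fam V ≃o fam V0 × TT) := by
  have hsub : ∀ A ∈ fam V0, A ⊆ V0 := by
    rintro A ⟨f, rfl⟩ u hu; exact hu.1
  have hnon : ∀ A ∈ fam V0, A.Nonempty := by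
    rintro A ⟨f, rfl⟩; exact EE_nonempty hne _
  let G : Set (Perm (Fin n)) → Set Bool → Set (Perm (Fin n)) := fun A S =>
    {u | (false ∈ S ∧ u ∈ A) ∨ (true ∈ S ∧ u ∈ φ '' A)}
  have G1 : ∀ A, G A {false} = A := by intro A; ext u; simp [G]
  have G2 : ∀ A, G A {true} = φ '' A := by intro A; ext u; simp [G]
  have G3 : ∀ A, G A Set.univ = A ∪ φ '' A := by intro A; ext u; simp [G]
  have hT : ∀ S : TT, S.1 = {false} ∨ S.1 = {true} ∨ S.1 = Set.univ := by
    rintro ⟨S, hS⟩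
    by_cases hf : false ∈ S <;> by_cases ht : true ∈ S
    · right; right; ext x; cases x <;> simp [hf, ht]
    · left; ext x; cases x <;> simp [hf, ht]
    · right; left; ext x; cases x <;> simp [hf, ht]
    · exfalso; obtain ⟨x, hx⟩ := hS; cases x <;> contradiction
  have hG : ∀ (A : fam V0) (S : TT), G A.1 S.1 ∈ fam V := by
    intro A S
    obtain ⟨q1, q2, q3⟩ := h2 A.1 A.2
    rcases hT S with h | h | h <;> rw [h]
    · rwa [G1]
    · rwa [G2]
    · rwa [G3]
  let F : fam V0 × TT → fam V := fun q => ⟨G q.1.1 q.2.1, hG q.1 q.2⟩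
  have hF : ∀ q q', F q ≤ F q' ↔ q ≤ q' := by
    rintro ⟨⟨A, hA⟩, ⟨S, hS⟩⟩ ⟨⟨B, hB⟩, ⟨S', hS'⟩⟩
    change G A S ⊆ G B S' ↔ (A ⊆ B ∧ S ⊆ S')
    constructor
    · intro h
      have hfA : ∀ u ∈ A, false ∈ S → false ∈ S' ∧ u ∈ B := by
        intro u hu hf
        rcases h (Or.inl ⟨hf, hu⟩ : u ∈ G A S) with h' | ⟨-, v, hv, hvu⟩
        · exact h'
        · exact (hd v (hsub B hB hv) u (hsub A hA hu) hvu).elim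
      have htA : ∀ u ∈ A, true ∈ S → true ∈ S' ∧ u ∈ B := by
        intro u hu hf
        rcases h (Or.inr ⟨hf, u, hu, rfl⟩ : φ u ∈ G A S) with ⟨-, h'⟩ | ⟨h', v, hv, hvu⟩
        · exact (hd u (hsub A hA hu) _ (hsub B hB h') rfl).elim
        · exact ⟨h', hφ hvu ▸ hv⟩
      constructor
      · intro u hu
        obtain ⟨x, hx⟩ := hS
        cases x
        · exact (hfA u hu hx).2
        · exact (htA u hu hx).2
      · obtain ⟨u, hu⟩ := hnon A hA
        intro x hx
        cases x
        · exact (hfA u hu hx).1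
        · exact (htA u hu hx).1
    · rintro ⟨hAB, hSS⟩ u (⟨hf, hu⟩ | ⟨hf, v, hv, rfl⟩)
      · exact Or.inl ⟨hSS hf, hAB hu⟩
      · exact Or.inr ⟨hSS hf, v, hAB hv, rfl⟩
  have hsurj : Function.Surjective F := by
    rintro ⟨B, hB⟩
    obtain ⟨A, hA, h | h | h⟩ := h1 B hB
    · exact ⟨(⟨A, hA⟩, ⟨{false}, by simp⟩), Subtype.ext ((G1 A).trans h.symm)⟩
    · exact ⟨(⟨A, hA⟩, ⟨{true}, by simp⟩), Subtype.ext ((G2 A).trans h.symm)⟩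
    · exact ⟨(⟨A, hA⟩, ⟨Set.univ, by simp⟩), Subtype.ext ((G3 A).trans h.symm)⟩
  exact ⟨(RelIso.ofSurjective (OrderEmbedding.ofMapLEIff F hF) hsurj).symm⟩

/-- partial sums -/
noncomputable def TS {n : ℕ} (u : Perm (Fin n)) (f : Fin n → ℝ) (m : ℕ) : ℝ :=
  ∑ k, if m ≤ (u k).val then f k else 0

lemma val_eq {n : ℕ} (u : Perm (Fin n)) (f : Fin n → ℝ) :
    val u f = ∑ m ∈ Finset.range n, TS u f m := by
  unfold val TS
  rw [Finset.sum_comm]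
  refine Finset.sum_congr rfl fun k _ => ?_
  rw [← Finset.sum_filter, Finset.sum_const]
  have : (Finset.range n).filter (fun m => m ≤ (u k).val) = Finset.range ((u k).val + 1) := by
    ext m
    have := (u k).2
    simp only [Finset.mem_filter, Finset.mem_range]
    omega
  rw [this, Finset.card_range, nsmul_eq_mul, permPoint]
  push_cast
  ring

lemma TS_swap {n : ℕ} (u : Perm (Fin n)) (a b : Fin n) (f : Fin n → ℝ) (m : ℕ) :
    TS (u * swap a b) f m = TS u (fun k => f (swap a b k)) m := by
  unfold TS
  rw [← Equiv.sum_comp (swap a b)]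
  simp

lemma val_swap {n : ℕ} (u : Perm (Fin n)) (a b : Fin n) (f : Fin n → ℝ) :
    val (u * swap a b) f = val u (fun k => f (swap a b k)) := by
  rw [val_eq, val_eq]
  simp only [TS_swap]

lemma sum_swap_diff {n : ℕ} {a b : Fin n} (hab : a ≠ b) (f x : Fin n → ℝ) :
    ∑ k, x k * f (swap a b k) - ∑ k, x k * f k = (x b - x a) * (f a - f b) := by
  rw [← Finset.sum_sub_distrib]
  rw [Fintype.sum_eq_add a b hab]
  · simp; ring
  · rintro k ⟨h1, h2⟩
    rw [swap_apply_of_ne_of_ne h1 h2]; ring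

lemma TS_diff {n : ℕ} (u : Perm (Fin n)) {a b : Fin n} (hab : a ≠ b) (f : Fin n → ℝ) (m : ℕ) :
    TS (u * swap a b) f m - TS u f m =
      ((if m ≤ (u b).val then 1 else 0) - (if m ≤ (u a).val then 1 else 0)) * (f a - f b) := by
  rw [TS_swap]
  have := sum_swap_diff hab f (fun k => if m ≤ (u k).val then 1 else 0)
  simpa [TS] using this

lemma val_diff {n : ℕ} (u : Perm (Fin n)) {a b : Fin n} (hab : a ≠ b) (f : Fin n → ℝ) :
    val (u * swap a b) f - val u f =
      (((u b).val : ℝ) - (u a).val) * (f a - f b) := by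
  rw [val_swap]
  have := sum_swap_diff hab f (permPoint n u)
  simp only [val]
  simp only [mul_comm (f _)]
  rw [this]
  simp [permPoint]

/-- all partial sums are maximized simultaneously -/
def good {n : ℕ} (V : Set (Perm (Fin n))) : Prop :=
  ∀ f : Fin n → ℝ, ∃ u0 ∈ V, ∀ u ∈ V, ∀ m, TS u f m ≤ TS u0 f m

lemma good_LL {n : ℕ} : ∀ (N : ℕ) (w : Perm (Fin n)), inv w = N → good (LL w) := by
  intro N
  induction N with
  | zero =>
    intro w hw
    have : w = 1 := by
      by_contra hc
      obtain ⟨a, b, hab, h⟩ := exists_desc hc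
      have := inv_desc hab h
      omega
    subst this
    intro f
    refine ⟨1, fun _ _ => le_rfl, fun u hu m => ?_⟩
    rw [rle_one hu]
  | succ N ih =>
    intro w hw
    have hc : w ≠ 1 := by
      rintro rfl
      rw [inv_one] at hw
      omega
    obtain ⟨a, b, hab, h⟩ := exists_desc hc
    have h1 := inv_desc hab h
    have hne : a ≠ b := by intro h; subst h; omega
    have hV := ih (w * swap a b) (by omega)
    have key : ∀ f : Fin n → ℝ, f a ≤ f b →
        ∃ u0 ∈ LL w, ∀ u ∈ LL w, ∀ m, TS u f m ≤ TS u0 f m := by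
      intro f hf
      obtain ⟨u0, hu0, hm⟩ := hV f
      refine ⟨u0, rle_trans hu0 (rle_desc hab h), fun u hu m => ?_⟩
      rcases asc_or_desc u hab with h2 | h2
      · exact hm u (lift2 hab h h2 hu) m
      · refine le_trans ?_ (hm _ (lift1 hab h h2 hu) m)
        have h3 := TS_diff u hne f m
        have h4 : u b < u a := h2
        split_ifs at h3 with q1 q2 q2
        · linarith
        · omega
        · linarith
        · linarith
    intro f
    rcases le_total (f a) (f b) with hf | hf
    · exact key f hf
    · obtain ⟨u0, hu0, hm⟩ := key (fun k => f (swap a b k)) (by simpa using hf)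
      refine ⟨u0 * swap a b, lift3 hab h hu0, fun u hu m => ?_⟩
      rw [TS_swap]
      have := hm _ (lift3 hab h hu) m
      rw [← TS_swap, mul_assoc, swap_mul_self, mul_one] at this
      exact this

/-- `u` preserves the initial segment ending at `a` -/
def pres {n : ℕ} (a : Fin n) (u : Perm (Fin n)) : Prop := ∀ k, u k ≤ a ↔ k ≤ a

lemma pres_of {n : ℕ} {a : Fin n} {u : Perm (Fin n)} (h : ∀ k, k ≤ a → u k ≤ a) : pres a u := by
  intro k
  refine ⟨fun hk => ?_, h k⟩
  have h1 : Set.MapsTo u (Set.Iic a) (Set.Iic a) := fun k hk => h k hk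
  have h2 := ((Set.toFinite (Set.Iic a)).injOn_iff_bijOn_of_mapsTo h1).1 u.injective.injOn
  obtain ⟨j, hj, hjk⟩ := h2.surjOn (Set.mem_Iic.2 hk)
  rw [← u.injective hjk]
  exact hj

/-- shifted functional -/
noncomputable def sh {n : ℕ} (a : Fin n) (f : Fin n → ℝ) (t : ℝ) : Fin n → ℝ :=
  fun k => f k + if k ≤ a then t else 0

lemma val_sh {n : ℕ} {a : Fin n} {u : Perm (Fin n)} (hu : pres a u) (s : Perm (Fin n))
    (f : Fin n → ℝ) (t : ℝ) :
    val (s * u) (sh a f t) = val (s * u) f + t * ∑ k, if k ≤ a then permPoint n s k else 0 := by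
  have e : (∑ k, if k ≤ a then permPoint n s k else 0) =
      ∑ k, if k ≤ a then permPoint n (s * u) k else 0 := by
    rw [← Equiv.sum_comp u]
    refine Finset.sum_congr rfl fun k _ => ?_
    simp only [hu k]
    rfl
  rw [e, Finset.mul_sum]
  unfold val sh
  rw [← Finset.sum_add_distrib]
  refine Finset.sum_congr rfl fun k _ => ?_
  split_ifs <;> ring

lemma EE_sh {n : ℕ} {a : Fin n} {V : Set (Perm (Fin n))} (hV : ∀ u ∈ V, pres a u)
    (s : Perm (Fin n)) (f : Fin n → ℝ) (t : ℝ) :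
    EE V (fun u => val (s * u) (sh a f t)) = EE V (fun u => val (s * u) f) :=
  EE_congr _ fun u hu => val_sh (hV u hu) s f t

lemma EE_sh1 {n : ℕ} {a : Fin n} {V : Set (Perm (Fin n))} (hV : ∀ u ∈ V, pres a u)
    (f : Fin n → ℝ) (t : ℝ) :
    EE V (fun u => val u (sh a f t)) = EE V (fun u => val u f) := by
  simpa using EE_sh hV 1 f t

lemma right_cases {n : ℕ} {a b : Fin n} (hab : a.val + 1 = b.val) {V : Set (Perm (Fin n))}
    (hV : ∀ u ∈ V, pres a u) (f : Fin n → ℝ) :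
    (f a < f b → EE (V ∪ (· * swap a b) '' V) (fun u => val u f) = EE V (fun u => val u f)) ∧
    (f a = f b → EE (V ∪ (· * swap a b) '' V) (fun u => val u f) =
      EE V (fun u => val u f) ∪ (· * swap a b) '' EE V (fun u => val u f)) ∧
    (f b < f a → EE (V ∪ (· * swap a b) '' V) (fun u => val u f) =
      (· * swap a b) '' EE V (fun u => val u (fun k => f (swap a b k)))) := by
  have hne : a ≠ b := by intro h; subst h; omega
  have pos : ∀ u ∈ V, (0 : ℝ) < ((u b).val : ℝ) - (u a).val := by
    intro u hu
    have h1 := (hV u hu a).2 le_rfl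
    have h2 : ¬ u b ≤ a := fun h => by have := (hV u hu b).1 h; omega
    have h3 : (u a).val < (u b).val := by omega
    have : ((u a).val : ℝ) < (u b).val := by exact_mod_cast h3
    linarith
  refine ⟨fun h => ?_, fun h => ?_, fun h => ?_⟩
  · apply EE_union1
    intro u hu
    refine ⟨u, hu, ?_⟩
    have := val_diff u hne f
    have := mul_pos (pos u hu) (sub_pos.2 h)
    nlinarith
  · have e : ∀ u, val (u * swap a b) f = val u f := by
      intro u
      have := val_diff u hne f
      rw [h] at this
      linarith
    rw [EE_union3]
    · simp only [e]
    · intro u hu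
      exact ⟨u, hu, (e u).ge⟩
    · intro u hu
      exact ⟨u, hu, (e u).le⟩
  · rw [EE_union2]
    · simp only [val_swap]
    intro u hu
    refine ⟨u, hu, ?_⟩
    have := val_diff u hne f
    have := mul_pos (pos u hu) (sub_pos.2 h)
    linarith

lemma right_prism {n : ℕ} {a b : Fin n} (hab : a.val + 1 = b.val) {V : Set (Perm (Fin n))}
    (hV : ∀ u ∈ V, pres a u) (hne : V.Nonempty) :
    Nonempty (fam (V ∪ (· * swap a b) '' V) ≃o fam V × TT) := by
  have hba : ¬ b ≤ a := by omega
  apply prism hne (mul_left_injective (swap a b))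
  · intro u hu v hv h
    have h1 := (hV v hv a).2 le_rfl
    rw [← h] at h1
    simp only [Perm.mul_apply, swap_apply_left] at h1
    exact hba ((hV u hu b).1 h1)
  · rintro B ⟨f, rfl⟩
    obtain ⟨h1, h2, h3⟩ := right_cases hab hV f
    rcases lt_trichotomy (f a) (f b) with h | h | h
    · exact ⟨_, ⟨f, rfl⟩, Or.inl (h1 h)⟩
    · exact ⟨_, ⟨f, rfl⟩, Or.inr (Or.inr (h2 h))⟩
    · exact ⟨_, ⟨_, rfl⟩, Or.inr (Or.inl (h3 h))⟩
  · rintro A ⟨f, rfl⟩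
    refine ⟨⟨sh a f (f b - f a - 1), ?_⟩,
      ⟨fun k => sh a f (f b - f a - 1) (swap a b k), ?_⟩, ⟨sh a f (f b - f a), ?_⟩⟩
    · rw [(right_cases hab hV _).1, EE_sh1 hV]
      simp [sh, hba]
      linarith
    · rw [(right_cases hab hV _).2.2]
      · simp only [swap_apply_self]
        rw [EE_sh1 hV]
      · simp [sh, hba]
        linarith
    · rw [(right_cases hab hV _).2.1, EE_sh1 hV]
      simp [sh, hba]

lemma val_left {n : ℕ} {a b : Fin n} (hab : a.val + 1 = b.val) (u : Perm (Fin n))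
    (f : Fin n → ℝ) :
    val (swap a b * u) f = val u f + (TS u f a.val - 2 * TS u f b.val + TS u f (b.val + 1)) := by
  unfold val TS
  rw [Finset.mul_sum, ← Finset.sum_sub_distrib, ← Finset.sum_add_distrib,
    ← Finset.sum_add_distrib]
  refine Finset.sum_congr rfl fun k _ => ?_
  have hb : (b.val : ℝ) = a.val + 1 := by exact_mod_cast hab.symm
  unfold permPoint
  rw [Perm.mul_apply, swap_apply_def]
  by_cases h1 : u k = a
  · rw [if_pos h1, h1, if_pos le_rfl, if_neg (by omega), if_neg (by omega), hb]
    ring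
  rw [if_neg h1]
  by_cases h2 : u k = b
  · rw [if_pos h2, h2, if_pos (by omega), if_pos le_rfl, if_neg (by omega), hb]
    ring
  rw [if_neg h2]
  have h3 : (u k).val ≠ a.val := fun h => h1 (Fin.ext h)
  have h4 : (u k).val ≠ b.val := fun h => h2 (Fin.ext h)
  split_ifs <;> first | omega | ring

lemma TS_const {n : ℕ} {a b : Fin n} (hab : a.val + 1 = b.val) {u : Perm (Fin n)}
    (hu : pres a u) (f : Fin n → ℝ) :
    TS u f b.val = ∑ k, if k ≤ a then 0 else f k := by
  unfold TS
  refine Finset.sum_congr rfl fun k _ => ?_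
  have := hu k
  by_cases h : k ≤ a
  · rw [if_pos h, if_neg]
    have := this.2 h
    omega
  · rw [if_neg h, if_pos]
    have : ¬ u k ≤ a := fun h' => h (this.1 h')
    omega

lemma good_eq {n : ℕ} {f : Fin n → ℝ} {u0 u : Perm (Fin n)}
    (h : ∀ m, TS u f m ≤ TS u0 f m) (hv : val u0 f ≤ val u f) (m : ℕ) :
    TS u f m = TS u0 f m := by
  rw [val_eq, val_eq] at hv
  by_cases hm : m < n
  · have h1 : ∑ m ∈ Finset.range n, TS u f m ≤ ∑ m ∈ Finset.range n, TS u0 f m :=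
      Finset.sum_le_sum fun m _ => h m
    exact (Finset.sum_eq_sum_iff_of_le (fun m _ => h m)).1 (le_antisymm h1 hv) m
      (Finset.mem_range.2 hm)
  · have h0 : ∀ v : Perm (Fin n), TS v f m = 0 := by
      intro v
      refine Finset.sum_eq_zero fun k _ => ?_
      rw [if_neg]
      have := (v k).2
      omega
    rw [h0, h0]

lemma left_fan {n : ℕ} {a b : Fin n} (hab : a.val + 1 = b.val) {V : Set (Perm (Fin n))}
    (hV : ∀ u ∈ V, pres a u) (hg : good V) (f : Fin n → ℝ) :
    ∃ u0 ∈ V, (∀ u ∈ V, val u f ≤ val u0 f) ∧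
      (∀ u ∈ V, val (swap a b * u) f ≤ val (swap a b * u0) f) ∧
      EE V (fun u => val (swap a b * u) f) = EE V (fun u => val u f) := by
  obtain ⟨u0, hu0, hm⟩ := hg f
  have k1 : ∀ u ∈ V, val u f ≤ val u0 f := by
    intro u hu
    rw [val_eq, val_eq]
    exact Finset.sum_le_sum fun m _ => hm u hu m
  have k2 : ∀ u ∈ V, val (swap a b * u) f ≤ val (swap a b * u0) f := by
    intro u hu
    rw [val_left hab, val_left hab, TS_const hab (hV u hu), TS_const hab (hV u0 hu0)]
    linarith [k1 u hu, hm u hu a.val, hm u hu (b.val + 1)]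
  refine ⟨u0, hu0, k1, k2, ?_⟩
  ext u
  constructor
  · rintro ⟨hu, h⟩
    refine ⟨hu, fun v hv => (k1 v hv).trans ?_⟩
    have h1 := h u0 hu0
    simp only at h1
    rw [val_left hab, val_left hab, TS_const hab (hV u hu), TS_const hab (hV u0 hu0)] at h1
    simp only
    linarith [k1 u hu, hm u hu a.val, hm u hu (b.val + 1)]
  · rintro ⟨hu, h⟩
    refine ⟨hu, fun v hv => (k2 v hv).trans ?_⟩
    have h1 := h u0 hu0
    have h2 := good_eq (hm u hu) h1
    simp only at h1 ⊢
    rw [val_left hab, val_left hab, h2, h2, h2]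
    linarith

lemma left_prism {n : ℕ} {a b : Fin n} (hab : a.val + 1 = b.val) {V : Set (Perm (Fin n))}
    (hV : ∀ u ∈ V, pres a u) (hne : V.Nonempty) (hg : good V) :
    Nonempty (fam (V ∪ (swap a b * ·) '' V) ≃o fam V × TT) := by
  have hba : ¬ b ≤ a := by omega
  have c1 : (∑ k, if k ≤ a then permPoint n (swap a b) k else 0) =
      (∑ k, if k ≤ a then permPoint n 1 k else 0) + 1 := by
    rw [← sub_eq_iff_eq_add', ← Finset.sum_sub_distrib, Finset.sum_eq_single a]
    · have hb : (b.val : ℝ) = a.val + 1 := by exact_mod_cast hab.symm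
      simp [permPoint, hb]
    · intro k _ hk
      by_cases h : k ≤ a
      · have : k ≠ b := by omega
        simp [permPoint, h, swap_apply_of_ne_of_ne hk this]
      · simp [h]
    · simp
  apply prism hne (mul_right_injective (swap a b))
  · intro u hu v hv h
    have h1 := (hV v hv (u⁻¹ a)).2 ((hV u hu _).1 (by simp))
    rw [← h] at h1
    simp at h1
    omega
  · rintro B ⟨f, rfl⟩
    obtain ⟨u0, hu0, h1, h2, h3⟩ := left_fan hab hV hg f
    refine ⟨_, ⟨f, rfl⟩, ?_⟩
    rcases lt_trichotomy (val (swap a b * u0) f) (val u0 f) with h | h | h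
    · left
      exact EE_union1 fun u hu => ⟨u0, hu0, (h2 u hu).trans_lt h⟩
    · right; right
      rw [EE_union3, h3]
      · exact fun u hu => ⟨u0, hu0, (h1 u hu).trans h.ge⟩
      · exact fun u hu => ⟨u0, hu0, (h2 u hu).trans h.le⟩
    · right; left
      rw [EE_union2, h3]
      exact fun u hu => ⟨u0, hu0, (h1 u hu).trans_lt h⟩
  · rintro A ⟨f, rfl⟩
    obtain ⟨u0, hu0, h1, h2, h3⟩ := left_fan hab hV hg f
    have v1 : ∀ t, ∀ u ∈ V, val u (sh a f t) = val u f +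
        t * ∑ k, if k ≤ a then permPoint n 1 k else 0 := by
      intro t u hu
      simpa using val_sh (hV u hu) 1 f t
    have v2 : ∀ t, ∀ u ∈ V, val (swap a b * u) (sh a f t) = val (swap a b * u) f +
        t * ((∑ k, if k ≤ a then permPoint n 1 k else 0) + 1) := by
      intro t u hu
      rw [val_sh (hV u hu), c1]
    set C := ∑ k, if k ≤ a then permPoint n 1 k else 0
    set d := val (swap a b * u0) f - val u0 f with hd
    refine ⟨⟨sh a f (-d - 1), ?_⟩, ⟨sh a f (-d + 1), ?_⟩, ⟨sh a f (-d), ?_⟩⟩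
    · rw [EE_union1, EE_sh1 hV]
      intro u hu
      refine ⟨u0, hu0, ?_⟩
      rw [v1 _ _ hu0, v2 _ _ hu]
      linarith [h2 u hu]
    · rw [EE_union2, EE_sh hV, h3]
      intro u hu
      refine ⟨u0, hu0, ?_⟩
      rw [v1 _ _ hu, v2 _ _ hu0]
      linarith [h1 u hu]
    · rw [EE_union3, EE_sh hV, EE_sh1 hV, h3]
      · intro u hu
        refine ⟨u0, hu0, ?_⟩
        rw [v1 _ _ hu, v2 _ _ hu0]
        linarith [h1 u hu]
      · intro u hu
        refine ⟨u0, hu0, ?_⟩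
        rw [v1 _ _ hu0, v2 _ _ hu]
        linarith [h2 u hu]

lemma LL_right {n : ℕ} {w : Perm (Fin n)} {a b : Fin n} (hab : a.val + 1 = b.val)
    (h : w b < w a) : LL w = LL (w * swap a b) ∪ (· * swap a b) '' LL (w * swap a b) := by
  ext u
  constructor
  · intro hu
    rcases asc_or_desc u hab with h2 | h2
    · exact Or.inl (lift2 hab h h2 hu)
    · exact Or.inr ⟨u * swap a b, lift1 hab h h2 hu, by simp [mul_assoc]⟩
  · rintro (hu | ⟨v, hv, rfl⟩)
    · exact rle_trans hu (rle_desc hab h)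
    · exact lift3 hab h (rle_trans hv (rle_desc hab h))

lemma LL_inv {n : ℕ} (w : Perm (Fin n)) (u : Perm (Fin n)) : u ∈ LL w⁻¹ ↔ u⁻¹ ∈ LL w := by
  constructor
  · intro h
    have := rle_inv h
    change rle _ _
    simpa using this
  · intro h
    have := rle_inv h
    change rle _ _
    simpa using this

lemma LL_left {n : ℕ} {w : Perm (Fin n)} {a b : Fin n} (hab : a.val + 1 = b.val)
    (h : w b < w a) : LL w⁻¹ = LL (w * swap a b)⁻¹ ∪ (swap a b * ·) '' LL (w * swap a b)⁻¹ := by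
  ext u
  rw [LL_inv, LL_right hab h]
  constructor
  · rintro (hu | ⟨v, hv, hvu⟩)
    · exact Or.inl ((LL_inv _ _).2 hu)
    · refine Or.inr ⟨v⁻¹, (LL_inv _ _).2 (by simpa using hv), ?_⟩
      have := congrArg (·⁻¹) hvu
      simpa using this
  · rintro (hu | ⟨v, hv, rfl⟩)
    · exact Or.inl ((LL_inv _ _).1 hu)
    · exact Or.inr ⟨v⁻¹, (LL_inv _ _).1 hv, by simp⟩

lemma LL_pres {n : ℕ} {w : Perm (Fin n)} {a : Fin n} (h : ∀ k, k ≤ a → w k ≤ a)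
    {u : Perm (Fin n)} (hu : u ∈ LL w) : pres a u := by
  apply pres_of
  intro k hk
  have := rle_pres hu (i := a.val + 1) (fun k hk => by have := h k (by omega); omega) k (by omega)
  omega

lemma LL_nonempty {n : ℕ} (w : Perm (Fin n)) : (LL w).Nonempty := ⟨1, one_rle w⟩

lemma step {n : ℕ} {w : Perm (Fin n)} {a b : Fin n} (h : RP w a b)
    (ih : Nonempty (fam (LL (w * swap a b)) ≃o fam (LL (w * swap a b)⁻¹))) :
    Nonempty (fam (LL w) ≃o fam (LL w⁻¹)) := by
  have hab := h.1
  obtain ⟨e⟩ := ih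
  have hp : ∀ u ∈ LL (w * swap a b), pres a u := fun u hu => LL_pres h.pres hu
  have hp' : ∀ u ∈ LL (w * swap a b)⁻¹, pres a u := by
    intro u hu k
    have := hp _ ((LL_inv _ _).1 hu) (u k)
    have h2 : u⁻¹ (u k) = k := by simp
    rw [h2] at this
    exact this.symm
  obtain ⟨e1⟩ := right_prism hab hp (LL_nonempty _)
  obtain ⟨e2⟩ := left_prism hab hp' (LL_nonempty _) (good_LL _ _ rfl)
  rw [← LL_right hab h.2.1] at e1
  rw [← LL_left hab h.2.1] at e2
  let e3 : fam (LL (w * swap a b)) × TT ≃o fam (LL (w * swap a b)⁻¹) × TT :=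
    { toEquiv := Equiv.prodCongr e.toEquiv (Equiv.refl TT)
      map_rel_iff' := by
        rintro ⟨x, s⟩ ⟨y, t⟩
        simp [Prod.mk_le_mk] }
  exact ⟨e1.trans (e3.trans e2.symm)⟩

lemma fam_iso {n : ℕ} : ∀ (N : ℕ) (w : Perm (Fin n)), inv w = N → HH w →
    Nonempty (fam (LL w) ≃o fam (LL w⁻¹)) := by
  intro N
  induction N using Nat.strong_induction_on with
  | _ N ih =>
  intro w hw hh
  by_cases hr : ∃ a b, RP w a b
  · obtain ⟨a, b, hab⟩ := hr
    have := inv_desc hab.1 hab.2.1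
    exact step hab (ih _ (by omega) _ rfl (hab.HH hh))
  by_cases hl : ∃ a b, RP w⁻¹ a b
  · obtain ⟨a, b, hab⟩ := hl
    have := inv_desc hab.1 hab.2.1
    rw [inv_inv] at this
    obtain ⟨e⟩ := step hab (ih _ (by omega) _ rfl (hab.HH hh.inv))
    rw [_root_.inv_inv] at e
    exact ⟨e.symm⟩
  push Not at hr hl
  rw [core hh hr hl]
  exact ⟨OrderIso.refl _⟩

/-! Convex geometry -/

/-- the polytope -/
noncomputable def PP {n : ℕ} (V : Set (Perm (Fin n))) : Set (Fin n → ℝ) :=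
  convexHull ℝ (permPoint n '' V)

/-- vertices in a set -/
def vt {n : ℕ} (V : Set (Perm (Fin n))) (F : Set (Fin n → ℝ)) : Set (Perm (Fin n)) :=
  {u | u ∈ V ∧ permPoint n u ∈ F}

lemma mem_PP {n : ℕ} {V : Set (Perm (Fin n))} {u : Perm (Fin n)} (hu : u ∈ V) :
    permPoint n u ∈ PP V := subset_convexHull _ _ ⟨u, hu, rfl⟩

lemma hullB {n : ℕ} {V : Set (Perm (Fin n))} {F : Set (Fin n → ℝ)} (hF : IsFaceOf (PP V) F) :
    convexHull ℝ (permPoint n '' (V \ vt V F)) ⊆ PP V \ F := by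
  apply convexHull_min
  · rintro x ⟨u, ⟨hu, hu'⟩, rfl⟩
    exact ⟨mem_PP hu, fun h => hu' ⟨hu, h⟩⟩
  · exact hF.1.convex_diff (convex_convexHull _ _)

lemma face_eq {n : ℕ} {V : Set (Perm (Fin n))} {F : Set (Fin n → ℝ)} (hF : IsFaceOf (PP V) F) :
    convexHull ℝ (permPoint n '' vt V F) = F := by
  apply Set.Subset.antisymm
  · apply convexHull_min
    · rintro x ⟨u, ⟨hu, hu'⟩, rfl⟩
      exact hu'
    · exact hF.2
  · intro x hx
    have hxP : x ∈ PP V := hF.1.1 hx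
    have hU : V = vt V F ∪ (V \ vt V F) := by
      rw [Set.union_sdiff_self]
      exact (Set.union_eq_self_of_subset_left fun u hu => hu.1).symm
    have hB := hullB hF
    rcases (vt V F).eq_empty_or_nonempty with h0 | h0
    · rw [h0] at hB
      simp only [Set.sdiff_empty] at hB
      exact ((hB hxP).2 hx).elim
    rcases (V \ vt V F).eq_empty_or_nonempty with h1 | h1
    · rw [h1, Set.union_empty] at hU
      rw [← hU]
      exact hxP
    have hx2 : x ∈ convexHull ℝ (permPoint n '' vt V F ∪ permPoint n '' (V \ vt V F)) := by
      rw [← Set.image_union, ← hU]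
      exact hxP
    rw [convexHull_union (h0.image _) (h1.image _), mem_convexJoin] at hx2
    obtain ⟨a, ha, b, hb, hab⟩ := hx2
    have hbF := hB hb
    rw [← insert_endpoints_openSegment] at hab
    rcases hab with rfl | rfl | hab
    · exact ha
    · exact (hbF.2 hx).elim
    · have haP : a ∈ PP V := convexHull_mono (Set.image_mono fun u hu => hu.1) ha
      rw [openSegment_symm] at hab
      exact (hbF.2 (hF.1.2 hbF.1 haP hx hab)).elim

lemma affine_inter {n : ℕ} {P F : Set (Fin n → ℝ)} (hF : IsFaceOf P F) (hne : F.Nonempty)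
    {y : Fin n → ℝ} (hy : y ∈ P) (hy2 : y ∈ affineSpan ℝ F) : y ∈ F := by
  obtain ⟨x, hx⟩ := hne.intrinsicInterior hF.2
  have hxF : x ∈ F := intrinsicInterior_subset hx
  obtain ⟨x', hx', rfl⟩ := mem_intrinsicInterior.1 hx
  let g : ℝ → affineSpan ℝ F := fun t =>
    ⟨AffineMap.lineMap (x' : Fin n → ℝ) y (-t), AffineMap.lineMap_mem _ x'.2 hy2⟩
  have hg : Continuous g := by
    apply Continuous.subtype_mk
    exact (AffineMap.lineMap_continuous).comp continuous_neg
  have h0 : g 0 = x' := by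
    apply Subtype.ext
    simp [g]
  have hev : ∀ᶠ t in nhds (0 : ℝ), g t ∈ interior ((↑) ⁻¹' F : Set (affineSpan ℝ F)) := by
    apply hg.continuousAt.eventually_mem
    rw [h0]
    exact isOpen_interior.mem_nhds hx'
  obtain ⟨t, ht, ht0⟩ := ((hev.filter_mono nhdsWithin_le_nhds).and
    (self_mem_nhdsWithin : Set.Ioi (0:ℝ) ∈ nhdsWithin 0 (Set.Ioi 0))).exists
  have ht0 : 0 < t := ht0
  have htF : AffineMap.lineMap (x' : Fin n → ℝ) y (-t) ∈ F :=
    (interior_subset ht : g t ∈ ((↑) ⁻¹' F : Set (affineSpan ℝ F)))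
  refine hF.1.2 hy (hF.1.1 htF) hxF ⟨t / (1 + t), 1 / (1 + t), by positivity, by positivity,
    by rw [← add_div, add_comm, div_self (by positivity)], ?_⟩
  ext k
  simp only [AffineMap.lineMap_apply, Pi.add_apply, Pi.smul_apply, smul_eq_mul, vsub_eq_sub,
    vadd_eq_add, Pi.sub_apply]
  field_simp
  ring

lemma sum_eq_val {n : ℕ} (l : (Fin n → ℝ) →L[ℝ] ℝ) (u : Perm (Fin n)) :
    l (permPoint n u) = val u (fun k => l (Pi.single k 1)) := by
  have := LinearMap.pi_apply_eq_sum_univ (l : (Fin n → ℝ) →ₗ[ℝ] ℝ) (permPoint n u)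
  unfold val
  simp only [ContinuousLinearMap.coe_coe, smul_eq_mul] at this
  rw [this]
  refine Finset.sum_congr rfl fun k _ => ?_
  rw [mul_comm]
  congr 2
  ext j
  simp [Pi.single_apply, eq_comm]

lemma face_fam {n : ℕ} {V : Set (Perm (Fin n))} {F : Set (Fin n → ℝ)} (hF : IsFaceOf (PP V) F)
    (hne : F.Nonempty) : vt V F ∈ fam V := by
  have hB := hullB hF
  obtain ⟨l, s, t, h1, h2, h3⟩ := geometric_hahn_banach_compact_closed
    (convex_convexHull ℝ (permPoint n '' (V \ vt V F)))
    ((Set.toFinite (permPoint n '' (V \ vt V F))).isCompact_convexHull ℝ)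
    (affineSpan ℝ F).convex (affineSpan ℝ F).closed_of_finiteDimensional (by
      rw [Set.disjoint_left]
      intro y hy hy2
      exact (hB hy).2 (affine_inter hF hne (hB hy).1 hy2))
  have hconst : ∀ x ∈ F, ∀ y ∈ F, l x = l y := by
    intro x hx y hy
    by_contra hc
    have hd : l y - l x ≠ 0 := fun h => hc (by linarith)
    have := h3 (AffineMap.lineMap x y ((t - l x) / (l y - l x)))
      (AffineMap.lineMap_mem _ (subset_affineSpan ℝ F hx) (subset_affineSpan ℝ F hy))
    simp only [AffineMap.lineMap_apply, vsub_eq_sub, vadd_eq_add, map_add, map_smul, map_sub,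
      smul_eq_mul] at this
    rw [div_mul_cancel₀ _ hd] at this
    linarith
  have hlt : ∀ v ∈ V, v ∉ vt V F → ∀ x ∈ F, l (permPoint n v) < l x := by
    intro v hv hv' x hx
    have := h1 _ (subset_convexHull ℝ _ ⟨v, ⟨hv, hv'⟩, rfl⟩)
    have := h3 x (subset_affineSpan ℝ F hx)
    linarith
  have hA : (vt V F).Nonempty := by
    have := face_eq hF
    by_contra hc
    rw [Set.not_nonempty_iff_eq_empty] at hc
    rw [hc] at this
    simp at this
    rw [← this] at hne
    exact Set.not_nonempty_empty hne
  obtain ⟨a, ha⟩ := hA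
  refine ⟨fun k => l (Pi.single k 1), ?_⟩
  simp only [← sum_eq_val]
  ext u
  constructor
  · intro hu
    refine ⟨hu.1, fun v hv => ?_⟩
    by_cases hvA : v ∈ vt V F
    · exact (hconst _ hvA.2 _ hu.2).le
    · exact (hlt v hv hvA _ hu.2).le
  · rintro ⟨hu, hm⟩
    by_contra hc
    exact absurd (hm a ha.1) (not_le.2 (hlt u hu hc _ ha.2))

lemma fam_face {n : ℕ} {V : Set (Perm (Fin n))} {A : Set (Perm (Fin n))}
    (hA : A ∈ fam V) (hAne : A.Nonempty) :
    IsFaceOf (PP V) (convexHull ℝ (permPoint n '' A)) ∧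
      vt V (convexHull ℝ (permPoint n '' A)) = A := by
  obtain ⟨f, rfl⟩ := hA
  obtain ⟨a, ha⟩ := hAne
  let l0 : (Fin n → ℝ) →ₗ[ℝ] ℝ := ∑ k, f k • LinearMap.proj k
  let l : (Fin n → ℝ) →L[ℝ] ℝ := LinearMap.toContinuousLinearMap l0
  have hl : ∀ u, l (permPoint n u) = val u f := by
    intro u
    simp [l, l0, val, LinearMap.sum_apply]
  have hmax : ∀ x ∈ PP V, l x ≤ val a f := by
    have : PP V ⊆ {x | l x ≤ val a f} := by
      apply convexHull_min
      · rintro x ⟨u, hu, rfl⟩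
        change l _ ≤ _
        rw [hl]
        exact ha.2 u hu
      · exact convex_halfSpace_le l.toLinearMap.isLinear _
    exact this
  let F : Set (Fin n → ℝ) := {x ∈ PP V | ∀ y ∈ PP V, l y ≤ l x}
  have hexp : IsExposed ℝ (PP V) F := fun _ => ⟨l, rfl⟩
  have hF : IsFaceOf (PP V) F := ⟨hexp.isExtreme, hexp.convex (convex_convexHull _ _)⟩
  have hvt : vt V F = EE V (fun u => val u f) := by
    ext u
    constructor
    · rintro ⟨hu, hu'⟩
      refine ⟨hu, fun v hv => ?_⟩
      have := hu'.2 _ (mem_PP hv)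
      rwa [hl, hl] at this
    · rintro ⟨hu, hm⟩
      refine ⟨hu, mem_PP hu, fun y hy => (hmax y hy).trans ?_⟩
      rw [hl]
      exact hm a ha.1
  have := face_eq hF
  rw [hvt] at this
  rw [this]
  exact ⟨hF, hvt⟩

lemma face_iso {n : ℕ} {V : Set (Perm (Fin n))} (hV : V.Nonempty) :
    Nonempty (WithBot (fam V) ≃o {A : Set (Fin n → ℝ) // IsFaceOf (PP V) A}) := by
  have hnon : ∀ A : fam V, A.1.Nonempty := by
    rintro ⟨A, f, rfl⟩; exact EE_nonempty hV _
  let G : WithBot (fam V) → {A : Set (Fin n → ℝ) // IsFaceOf (PP V) A} := fun x =>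
    match x with
    | ⊥ => ⟨∅, ⟨Set.empty_subset _, by simp⟩, convex_empty⟩
    | (A : fam V) => ⟨convexHull ℝ (permPoint n '' A.1), (fam_face A.2 (hnon A)).1⟩
  have hG : ∀ x y, G x ≤ G y ↔ x ≤ y := by
    intro x y
    induction x with
    | bot =>
      simp only [bot_le, iff_true]
      exact Set.empty_subset _
    | coe A =>
      have hAne : (convexHull ℝ (permPoint n '' A.1)).Nonempty := ((hnon A).image _).convexHull
      induction y with
      | bot =>
        constructor
        · intro h
          obtain ⟨x, hx⟩ := hAne
          exact (h hx : x ∈ (∅ : Set (Fin n → ℝ))).elim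
        · intro h
          exact absurd h (by simp)
      | coe B =>
        rw [WithBot.coe_le_coe]
        change convexHull ℝ (permPoint n '' A.1) ⊆ convexHull ℝ (permPoint n '' B.1) ↔ A.1 ⊆ B.1
        constructor
        · intro h
          rw [← (fam_face A.2 (hnon A)).2, ← (fam_face B.2 (hnon B)).2]
          exact fun u hu => ⟨hu.1, h hu.2⟩
        · exact fun h => convexHull_mono (Set.image_mono h)
  have hs : Function.Surjective G := by
    rintro ⟨F, hF⟩
    rcases F.eq_empty_or_nonempty with rfl | hne
    · exact ⟨⊥, rfl⟩
    · exact ⟨((⟨vt V F, face_fam hF hne⟩ : fam V) : WithBot (fam V)), Subtype.ext (face_eq hF)⟩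
  exact ⟨RelIso.ofSurjective (OrderEmbedding.ofMapLEIff G hG) hs⟩

lemma BIP_eq {n : ℕ} (w : Perm (Fin n)) : BIP n 1 w = PP (LL w) := by
  unfold BIP PP
  congr 1
  ext x
  constructor
  · rintro ⟨u, -, hu, rfl⟩
    exact ⟨u, (bruhat_iff _ _).1 hu, rfl⟩
  · rintro ⟨u, hu, rfl⟩
    exact ⟨u, (bruhat_iff _ _).2 (one_rle u), (bruhat_iff _ _).2 hu, rfl⟩

lemma final {n : ℕ} (w : Perm (Fin n))
    (h : numOcc w pattern321 + numOcc w pattern3412 = 1) :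
    CombEquiv (BIP n 1 w) (BIP n 1 w⁻¹) := by
  rw [BIP_eq, BIP_eq]
  obtain ⟨e⟩ := fam_iso _ w rfl (HH_of h)
  obtain ⟨e1⟩ := face_iso (LL_nonempty w)
  obtain ⟨e2⟩ := face_iso (LL_nonempty w⁻¹)
  let E := (e1.symm.trans e.withBotCongr).trans e2
  exact ⟨E.toEquiv, fun A B => (E.le_iff_le (x := A) (y := B)).symm⟩

end BIPproof

/-- If the total number of occurrences of the patterns 321 and 3412
in `w` equals 1, then `Q_{e,w}` and `Q_{e,w⁻¹}` are combinatorially equivalent. -/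
theorem stmt19 (n : ℕ) (w : Equiv.Perm (Fin n))
    (h : numOcc w pattern321 + numOcc w pattern3412 = 1) :
    CombEquiv (BIP n 1 w) (BIP n 1 w⁻¹) := by
  exact BIPproof.final w h
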